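/- There exists a finitely presented group with undecidable conjugacy problem whose Dehn function is equivalent to n³ and whose smallest isodiametric function is linear (equivalent to n). -/

import Mathlib

/-- `f ⪯ g`: there are nonnegative constants `a, b, c, d` with
`f n ≤ a * g (b * n) + c * n + d` for all `n`. -/
def FunLe (f g : ℕ → ℕ) : Prop :=
  ∃ a b c d : ℕ, ∀ n, f n ≤ a * g (b * n) + c * n + d

/-- Two functions are equivalent if each is `⪯` the other. -/
def FunEquiv (f g : ℕ → ℕ) : Prop := FunLe f g ∧ FunLe g f

/-- A function is superadditive if `f m + f n ≤ f (m + n)` for all `m, n`. -/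
def Superadditive (f : ℕ → ℕ) : Prop := ∀ m n, f m + f n ≤ f (m + n)
/-! ### Finite presentations, Dehn functions and isodiametric functions -/

/-- A word over an alphabet `X` together with formal inverses. -/
abbrev Word (X : Type) := List (X × Bool)

/-- The word `w` represents the identity in the group presented by `⟨X | rels⟩`. -/
def OneIn {X : Type} (rels : Set (FreeGroup X)) (w : Word X) : Prop :=
  FreeGroup.mk w ∈ Subgroup.normalClosure rels

/-- `w` is (in the free group) a product of at most `m` conjugates of relators from
`rels` (or their inverses). -/
def AreaLE {X : Type} (rels : Set (FreeGroup X)) (w : Word X) (m : ℕ) : Prop :=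
  ∃ L : List (FreeGroup X), L.length ≤ m ∧
    (∀ g ∈ L, ∃ x r, (r ∈ rels ∨ r⁻¹ ∈ rels) ∧ g = x * r * x⁻¹) ∧
    L.prod = FreeGroup.mk w

/-- `f` is an isoperimetric function of the presentation `⟨X | rels⟩`. -/
def IsIsoperimetric {X : Type} (rels : Set (FreeGroup X)) (f : ℕ → ℕ) : Prop :=
  ∀ n, ∀ w : Word X, w.length ≤ n → OneIn rels w → AreaLE rels w (f n)

/-- `d` is the Dehn function of the presentation `⟨X | rels⟩`, i.e. the (pointwise)
smallest isoperimetric function. -/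
def IsDehnFunction {X : Type} (rels : Set (FreeGroup X)) (d : ℕ → ℕ) : Prop :=
  IsIsoperimetric rels d ∧ ∀ f, IsIsoperimetric rels f → ∀ n, d n ≤ f n

/-- `w` is (in the free group) a product of conjugates `x⁻¹ r x` of relators `r ∈ rels`
(or inverses) with all conjugating words `x` of length `≤ m`. -/
def DiamLE {X : Type} (rels : Set (FreeGroup X)) (w : Word X) (m : ℕ) : Prop :=
  ∃ L : List (Word X × FreeGroup X),
    (∀ p ∈ L, p.1.length ≤ m ∧ (p.2 ∈ rels ∨ p.2⁻¹ ∈ rels)) ∧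
    (L.map fun p => (FreeGroup.mk p.1)⁻¹ * p.2 * FreeGroup.mk p.1).prod = FreeGroup.mk w

/-- `f` is an isodiametric function of the presentation `⟨X | rels⟩`. -/
def IsIsodiametric {X : Type} (rels : Set (FreeGroup X)) (f : ℕ → ℕ) : Prop :=
  ∀ n, ∀ w : Word X, w.length ≤ n → OneIn rels w → DiamLE rels w (f n)

/-- `d` is the smallest isodiametric function of the presentation `⟨X | rels⟩`. -/
def IsSmallestIsodiametric {X : Type} (rels : Set (FreeGroup X)) (d : ℕ → ℕ) : Prop :=
  IsIsodiametric rels d ∧ ∀ f, IsIsodiametric rels f → ∀ n, d n ≤ f n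

/-- The words `w₁` and `w₂` represent conjugate elements of the group presented
by `⟨X | rels⟩`. -/
def ConjIn {X : Type} (rels : Set (FreeGroup X)) (w₁ w₂ : Word X) : Prop :=
  ∃ x : FreeGroup X,
    x * FreeGroup.mk w₁ * x⁻¹ * (FreeGroup.mk w₂)⁻¹ ∈ Subgroup.normalClosure rels

section Filling

variable {X : Type} [DecidableEq X] {rels : Set (FreeGroup X)}

/-- `g` is a product of at most `N` conjugates of relators (or their inverses), with conjugating
elements of norm at most `M`. -/
def Filling (rels : Set (FreeGroup X)) (N M : ℕ) (g : FreeGroup X) : Prop :=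
  ∃ L : List (FreeGroup X × FreeGroup X), L.length ≤ N ∧
    (∀ p ∈ L, p.1.norm ≤ M ∧ (p.2 ∈ rels ∨ p.2⁻¹ ∈ rels)) ∧
    (L.map fun p => p.1⁻¹ * p.2 * p.1).prod = g

namespace Filling

theorem one : Filling rels 0 0 1 := ⟨[], by simp⟩

theorem of_mem {r : FreeGroup X} (hr : r ∈ rels) : Filling rels 1 0 r :=
  ⟨[(1, r)], by simp [hr]⟩

theorem mono {N M N' M' : ℕ} {g : FreeGroup X} (h : Filling rels N M g) (hN : N ≤ N')
    (hM : M ≤ M') : Filling rels N' M' g := by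
  obtain ⟨L, h1, h2, h3⟩ := h
  exact ⟨L, h1.trans hN, fun p hp => ⟨(h2 p hp).1.trans hM, (h2 p hp).2⟩, h3⟩

theorem mul {N N' M : ℕ} {g g' : FreeGroup X} (h : Filling rels N M g)
    (h' : Filling rels N' M g') : Filling rels (N + N') M (g * g') := by
  obtain ⟨L, h1, h2, h3⟩ := h
  obtain ⟨L', h1', h2', h3'⟩ := h'
  refine ⟨L ++ L', by simp only [List.length_append]; omega, ?_, by simp [h3, h3']⟩
  intro p hp
  rcases List.mem_append.1 hp with hp | hp
  exacts [h2 p hp, h2' p hp]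

theorem conj {N M D : ℕ} {g c : FreeGroup X} (h : Filling rels N M g) (hc : c.norm ≤ D) :
    Filling rels N (M + D) (c * g * c⁻¹) := by
  obtain ⟨L, h1, h2, h3⟩ := h
  refine ⟨L.map fun p => (p.1 * c⁻¹, p.2), by simpa using h1, ?_, ?_⟩
  · intro p hp
    obtain ⟨p', hp', rfl⟩ := List.mem_map.1 hp
    refine ⟨(FreeGroup.norm_mul_le _ _).trans ?_, (h2 p' hp').2⟩
    rw [FreeGroup.norm_inv_eq]
    exact add_le_add (h2 p' hp').1 hc
  · rw [← h3]
    clear h1 h2 h3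
    induction L with
    | nil => simp
    | cons p L ih =>
      simp only [List.map_cons, List.prod_cons] at ih ⊢
      rw [ih]
      group

theorem inv {N M : ℕ} {g : FreeGroup X} (h : Filling rels N M g) : Filling rels N M g⁻¹ := by
  obtain ⟨L, h1, h2, h3⟩ := h
  refine ⟨(L.map fun p => (p.1, p.2⁻¹)).reverse, by simpa using h1, ?_, ?_⟩
  · intro p hp
    obtain ⟨p', hp', rfl⟩ := List.mem_map.1 (List.mem_reverse.1 hp)
    exact ⟨(h2 p' hp').1, by simpa using (h2 p' hp').2.symm⟩
  · rw [← h3, List.prod_inv_reverse, List.map_reverse, List.map_map, List.map_map]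
    congr 3
    funext p
    simp [mul_assoc]

theorem areaLE {N M : ℕ} {w : Word X} (h : Filling rels N M (FreeGroup.mk w)) :
    AreaLE rels w N := by
  obtain ⟨L, h1, h2, h3⟩ := h
  refine ⟨_, by simpa using h1, ?_, h3⟩
  intro g hg
  obtain ⟨p, hp, rfl⟩ := List.mem_map.1 hg
  exact ⟨p.1⁻¹, p.2, (h2 p hp).2, by simp⟩

theorem diamLE {N M : ℕ} {w : Word X} (h : Filling rels N M (FreeGroup.mk w)) :
    DiamLE rels w M := by
  obtain ⟨L, h1, h2, h3⟩ := h
  refine ⟨L.map fun p => (p.1.toWord, p.2), ?_, ?_⟩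
  · intro p hp
    obtain ⟨p', hp', rfl⟩ := List.mem_map.1 hp
    exact h2 p' hp'
  · rw [← h3, List.map_map]
    congr 2
    funext p
    simp only [Function.comp_apply, FreeGroup.mk_toWord]

end Filling

/-- `g = ρ * h` where `ρ` has a filling with the given bounds. -/
def Near (rels : Set (FreeGroup X)) (N M : ℕ) (g h : FreeGroup X) : Prop :=
  Filling rels N M (g * h⁻¹)

namespace Near

theorem refl (g : FreeGroup X) : Near rels 0 0 g g := by simpa [Near] using Filling.one

theorem mono {N M N' M' : ℕ} {g h : FreeGroup X} (H : Near rels N M g h) (hN : N ≤ N')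
    (hM : M ≤ M') : Near rels N' M' g h := Filling.mono H hN hM

theorem trans {N N' M : ℕ} {g h k : FreeGroup X} (H : Near rels N M g h)
    (H' : Near rels N' M h k) : Near rels (N + N') M g k := by
  simpa [Near, mul_assoc] using Filling.mul H H'

theorem conj {N M D : ℕ} {g h c : FreeGroup X} (H : Near rels N M g h) (hc : c.norm ≤ D) :
    Near rels N (M + D) (c * g * c⁻¹) (c * h * c⁻¹) := by
  simpa [Near, mul_assoc] using Filling.conj H hc

theorem mul {N N' M M' D : ℕ} {g h g' h' : FreeGroup X} (H : Near rels N M g h)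
    (H' : Near rels N' M' g' h') (hg : g.norm ≤ D) (hM : M ≤ M' + D) :
    Near rels (N + N') (M' + D) (g * g') (h * h') := by
  have := (Filling.conj H' hg).mul (Filling.mono H le_rfl hM)
  rw [add_comm N' N] at this
  simpa [Near, mul_assoc] using this

theorem inv {N M D : ℕ} {g h : FreeGroup X} (H : Near rels N M g h) (hh : h.norm ≤ D) :
    Near rels N (M + D) g⁻¹ h⁻¹ := by
  have := Filling.conj (Filling.inv H) (c := h⁻¹) (D := D) (by simpa using hh)
  simpa [Near, mul_assoc] using this

end Near

end Filling

section FreeByFree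

variable {A K : Type}

/-- The endomorphism of the free group on `q = none` and the letters `some a` fixing each
`some a` and sending `q` to `u q v`. -/
def twistHom (u v : FreeGroup A) : FreeGroup (Option A) →* FreeGroup (Option A) :=
  FreeGroup.lift fun z => z.elim
    (FreeGroup.map some u * FreeGroup.of none * FreeGroup.map some v) fun a => FreeGroup.of (some a)

@[simp]
theorem twistHom_of_none (u v : FreeGroup A) : twistHom u v (FreeGroup.of none) =
    FreeGroup.map some u * FreeGroup.of none * FreeGroup.map some v := by
  simp [twistHom]

@[simp]
theorem twistHom_of_some (u v : FreeGroup A) (a : A) :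
    twistHom u v (FreeGroup.of (some a)) = FreeGroup.of (some a) := by
  simp [twistHom]

@[simp]
theorem twistHom_map_some (u v w : FreeGroup A) :
    twistHom u v (FreeGroup.map some w) = FreeGroup.map some w := by
  have : (twistHom u v).comp (FreeGroup.map some) = FreeGroup.map some := by
    ext a
    simp
  exact DFunLike.congr_fun this w

theorem twistHom_comp (u v u' v' : FreeGroup A) :
    (twistHom u v).comp (twistHom u' v') = twistHom (u' * u) (v * v') := by
  ext z
  cases z <;> simp [mul_assoc]

@[simp]
theorem twistHom_one : twistHom (1 : FreeGroup A) 1 = MonoidHom.id _ := by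
  ext z
  cases z <;> simp

/-- The automorphism `q ↦ u q v`. -/
def twist (u v : FreeGroup A) : MulAut (FreeGroup (Option A)) :=
  (twistHom u v).toMulEquiv (twistHom u⁻¹ v⁻¹) (by simp [twistHom_comp]) (by simp [twistHom_comp])

/-- The action of the free group on the letters `k` through the automorphisms
`q ↦ u k * q * v k`. -/
def twistAct (u v : K → FreeGroup A) : FreeGroup K →* MulAut (FreeGroup (Option A)) :=
  FreeGroup.lift fun k => twist (u k) (v k)

variable (u v : K → FreeGroup A)

theorem twistAct_of (k : K) (z : FreeGroup (Option A)) :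
    twistAct u v (FreeGroup.of k) z = twistHom (u k) (v k) z := by
  simp [twistAct, twist]

theorem twistAct_of_inv (k : K) (z : FreeGroup (Option A)) :
    twistAct u v (FreeGroup.of k)⁻¹ z = twistHom (u k)⁻¹ (v k)⁻¹ z := by
  rw [map_inv, MulAut.inv_apply, MulEquiv.symm_apply_eq, twistAct_of, ← MonoidHom.comp_apply,
    twistHom_comp]
  simp

/-- The inclusion of the base free group. -/
def baseHom : FreeGroup (Option A) →* FreeGroup (Option (A ⊕ K)) :=
  FreeGroup.map (Option.map Sum.inl)

/-- The inclusion of the free group on the stable letters. -/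
def stableHom : FreeGroup K →* FreeGroup (Option (A ⊕ K)) :=
  FreeGroup.map fun k => some (Sum.inr k)

/-- The relator saying that the stable letter `τ` (a generator or its inverse) acts on the base
generator `z` as prescribed. -/
def twistRelator (τ : K × Bool) (z : Option A) : FreeGroup (Option (A ⊕ K)) :=
  stableHom (FreeGroup.mk [τ]) * baseHom (FreeGroup.of z) * (stableHom (FreeGroup.mk [τ]))⁻¹ *
    (baseHom (twistAct u v (FreeGroup.mk [τ]) (FreeGroup.of z)))⁻¹

/-- The relators of the extension of a free group by a free group acting by twists. -/
def twistRels : Set (FreeGroup (Option (A ⊕ K))) :=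
  Set.range fun p : (K × Bool) × Option A => twistRelator u v p.1 p.2

theorem twistRels_finite [Finite A] [Finite K] : (twistRels u v).Finite :=
  Set.finite_range _

/-- The map onto the semidirect product. -/
def toSemidirect : FreeGroup (Option (A ⊕ K)) →*
    FreeGroup (Option A) ⋊[twistAct u v] FreeGroup K :=
  FreeGroup.lift fun z => match z with
    | none => SemidirectProduct.inl (FreeGroup.of none)
    | some (Sum.inl a) => SemidirectProduct.inl (FreeGroup.of (some a))
    | some (Sum.inr k) => SemidirectProduct.inr (FreeGroup.of k)

@[simp]
theorem toSemidirect_baseHom (g : FreeGroup (Option A)) :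
    toSemidirect u v (baseHom g) = SemidirectProduct.inl g := by
  have : (toSemidirect u v).comp baseHom = SemidirectProduct.inl := by
    ext z <;> cases z <;> simp [toSemidirect, baseHom]
  exact DFunLike.congr_fun this g

@[simp]
theorem toSemidirect_stableHom (g : FreeGroup K) :
    toSemidirect u v (stableHom g) = SemidirectProduct.inr g := by
  have : (toSemidirect u v).comp stableHom = SemidirectProduct.inr := by
    ext z <;> simp [toSemidirect, stableHom]
  exact DFunLike.congr_fun this g

theorem toSemidirect_twistRelator (τ : K × Bool) (z : Option A) :
    toSemidirect u v (twistRelator u v τ z) = 1 := by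
  simp only [twistRelator, map_mul, map_inv, toSemidirect_baseHom, toSemidirect_stableHom]
  rw [SemidirectProduct.inl_aut, map_inv, mul_inv_cancel]

theorem toSemidirect_eq_one {g : FreeGroup (Option (A ⊕ K))}
    (hg : g ∈ Subgroup.normalClosure (twistRels u v)) : toSemidirect u v g = 1 := by
  have : Subgroup.normalClosure (twistRels u v) ≤ (toSemidirect u v).ker := by
    refine Subgroup.normalClosure_le_normal ?_
    rintro _ ⟨p, rfl⟩
    exact toSemidirect_twistRelator u v p.1 p.2
  exact this hg

section Norms

variable [DecidableEq A] [DecidableEq K]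

theorem norm_map_le {α β : Type} [DecidableEq α] [DecidableEq β] (f : α → β) (g : FreeGroup α) :
    (FreeGroup.map f g).norm ≤ g.norm := by
  conv_lhs => rw [← FreeGroup.mk_toWord (x := g), FreeGroup.map.mk]
  refine FreeGroup.norm_mk_le.trans ?_
  simp [FreeGroup.norm]

theorem norm_baseHom_le (g : FreeGroup (Option A)) :
    (baseHom (K := K) g).norm ≤ g.norm := norm_map_le _ g

theorem norm_stableHom_le (g : FreeGroup K) :
    (stableHom (A := A) g).norm ≤ g.norm := norm_map_le _ g

variable {u v} {ℓ : ℕ}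

omit [DecidableEq K] in
theorem exists_twistAct_none (hu : ∀ k, (u k).norm ≤ ℓ) (hv : ∀ k, (v k).norm ≤ ℓ)
    (S : List (K × Bool)) : ∃ B C : FreeGroup A, B.norm ≤ ℓ * S.length ∧ C.norm ≤ ℓ * S.length ∧
      twistAct u v (FreeGroup.mk S) (FreeGroup.of none) =
        FreeGroup.map some B * FreeGroup.of none * FreeGroup.map some C := by
  induction S with
  | nil => exact ⟨1, 1, by simp, by simp, by simp [← FreeGroup.one_eq_mk]⟩
  | cons τ S ih =>
    obtain ⟨B, C, hB, hC, h⟩ := ih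
    have key : FreeGroup.mk (τ :: S) = FreeGroup.mk [τ] * FreeGroup.mk S := by
      simp [FreeGroup.mul_mk]
    rw [key, map_mul, MulAut.mul_apply, h]
    obtain ⟨k, b⟩ := τ
    have bound : ∀ {x y : FreeGroup A}, x.norm ≤ ℓ * S.length → y.norm ≤ ℓ →
        x.norm + y.norm ≤ ℓ * (S.length + 1) := by
      intro x y hx hy
      rw [mul_add, mul_one]
      exact add_le_add hx hy
    cases b
    · have : (FreeGroup.mk [(k, false)] : FreeGroup K) = (FreeGroup.of k)⁻¹ := by
        simp [FreeGroup.of, FreeGroup.inv_mk, FreeGroup.invRev]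
      rw [this, twistAct_of_inv]
      refine ⟨B * (u k)⁻¹, (v k)⁻¹ * C, (FreeGroup.norm_mul_le _ _).trans ?_,
        (FreeGroup.norm_mul_le _ _).trans ?_, by simp [mul_assoc]⟩
      · exact bound hB (by simpa using hu k)
      · rw [add_comm]
        exact bound hC (by simpa using hv k)
    · change ∃ _, _
      refine ⟨B * u k, v k * C, (FreeGroup.norm_mul_le _ _).trans ?_,
        (FreeGroup.norm_mul_le _ _).trans ?_, ?_⟩
      · exact bound hB (hu k)
      · rw [add_comm]
        exact bound hC (hv k)
      · change twistAct u v (FreeGroup.of k) _ = _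
        rw [twistAct_of]
        simp [mul_assoc]

omit [DecidableEq A] [DecidableEq K] in
theorem twistAct_some (g : FreeGroup K) (a : A) :
    twistAct u v g (FreeGroup.of (some a)) = FreeGroup.of (some a) := by
  induction g using FreeGroup.induction_on with
  | C1 => simp
  | of k => simp [twistAct_of]
  | inv_of k _ => rw [twistAct_of_inv, twistHom_of_some]
  | mul x y hx hy => rw [map_mul, MulAut.mul_apply, hy, hx]

omit [DecidableEq K] in
theorem norm_twistAct_of_le (hu : ∀ k, (u k).norm ≤ ℓ) (hv : ∀ k, (v k).norm ≤ ℓ)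
    (S : List (K × Bool)) (z : Option A) :
    (twistAct u v (FreeGroup.mk S) (FreeGroup.of z)).norm ≤ 2 * ℓ * S.length + 1 := by
  cases z with
  | none =>
    obtain ⟨B, C, hB, hC, h⟩ := exists_twistAct_none hu hv S
    rw [h]
    refine (FreeGroup.norm_mul_le _ _).trans ?_
    have h1 := FreeGroup.norm_mul_le (FreeGroup.map some B) (FreeGroup.of (none : Option A))
    have h2 := norm_map_le (some : A → Option A) B
    have h3 := norm_map_le (some : A → Option A) C
    rw [FreeGroup.norm_of] at h1
    rw [mul_assoc]
    omega
  | some a =>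
    rw [twistAct_some, FreeGroup.norm_of]
    omega

theorem norm_twistAct_letter_le (hu : ∀ k, (u k).norm ≤ ℓ) (hv : ∀ k, (v k).norm ≤ ℓ)
    (S : List (K × Bool)) (z : Option A × Bool) :
    (twistAct u v (FreeGroup.mk S) (FreeGroup.mk [z])).norm ≤ 2 * ℓ * S.length + 1 := by
  obtain ⟨z, b⟩ := z
  cases b
  · have : (FreeGroup.mk [(z, false)] : FreeGroup (Option A)) = (FreeGroup.of z)⁻¹ := by
      simp [FreeGroup.of, FreeGroup.inv_mk, FreeGroup.invRev]
    rw [this, map_inv, FreeGroup.norm_inv_eq]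
    exact norm_twistAct_of_le hu hv S z
  · exact norm_twistAct_of_le hu hv S z

end Norms

section Upper

variable [DecidableEq A] [DecidableEq K] {u v} {ℓ : ℕ}

theorem near_letter_letter (hu : ∀ k, (u k).norm ≤ ℓ) (hv : ∀ k, (v k).norm ≤ ℓ)
    (τ : K × Bool) (z : Option A × Bool) :
    Near (twistRels u v) 1 (2 * ℓ + 1)
      (stableHom (FreeGroup.mk [τ]) * baseHom (FreeGroup.mk [z]) *
        (stableHom (FreeGroup.mk [τ]))⁻¹)
      (baseHom (twistAct u v (FreeGroup.mk [τ]) (FreeGroup.mk [z]))) := by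
  have key : ∀ z : Option A, Near (twistRels u v) 1 0
      (stableHom (FreeGroup.mk [τ]) * baseHom (FreeGroup.of z) *
        (stableHom (FreeGroup.mk [τ]))⁻¹)
      (baseHom (twistAct u v (FreeGroup.mk [τ]) (FreeGroup.of z))) :=
    fun z => Filling.of_mem ⟨(τ, z), rfl⟩
  obtain ⟨z, b⟩ := z
  cases b
  · have : (FreeGroup.mk [(z, false)] : FreeGroup (Option A)) = (FreeGroup.of z)⁻¹ := by
      simp [FreeGroup.of, FreeGroup.inv_mk, FreeGroup.invRev]
    rw [this]
    have := (key z).inv (D := 2 * ℓ + 1) ((norm_baseHom_le _).trans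
      (by simpa using norm_twistAct_of_le hu hv [τ] z))
    simpa [mul_assoc] using this
  · exact (key z).mono le_rfl (Nat.zero_le _)

theorem near_letter_word (hu : ∀ k, (u k).norm ≤ ℓ) (hv : ∀ k, (v k).norm ≤ ℓ)
    (τ : K × Bool) (y : Word (Option A)) :
    Near (twistRels u v) y.length (2 * ℓ + 1 + (y.length + 2))
      (stableHom (FreeGroup.mk [τ]) * baseHom (FreeGroup.mk y) *
        (stableHom (FreeGroup.mk [τ]))⁻¹)
      (baseHom (twistAct u v (FreeGroup.mk [τ]) (FreeGroup.mk y))) := by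
  induction y using List.reverseRecOn with
  | nil =>
    rw [← FreeGroup.one_eq_mk]
    simpa using (Near.refl (rels := twistRels u v) 1).mono le_rfl (Nat.zero_le _)
  | append_singleton y z ih =>
    rw [← FreeGroup.mul_mk, map_mul, map_mul, map_mul]
    have hl := near_letter_letter hu hv τ z
    set s : FreeGroup (Option (A ⊕ K)) := stableHom (FreeGroup.mk [τ])
    have hs1 : s.norm ≤ 1 := (norm_stableHom_le _).trans FreeGroup.norm_mk_le
    have hn : (s * baseHom (FreeGroup.mk y) * s⁻¹).norm ≤ y.length + 2 := by
      have h1 := FreeGroup.norm_mul_le (s * baseHom (FreeGroup.mk y)) s⁻¹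
      have h2 := FreeGroup.norm_mul_le s (baseHom (FreeGroup.mk y))
      have h3 := (norm_baseHom_le (K := K) (FreeGroup.mk y)).trans FreeGroup.norm_mk_le
      rw [FreeGroup.norm_inv_eq] at h1
      omega
    have := ih.mul hl hn le_rfl
    refine Near.mono (by simpa [mul_assoc] using this) ?_ ?_ <;>
      simp only [List.length_append, List.length_singleton] <;> omega

theorem near_word_letter (hu : ∀ k, (u k).norm ≤ ℓ) (hv : ∀ k, (v k).norm ≤ ℓ)
    (n : ℕ) (S : List (K × Bool)) (hS : S.length ≤ n) (z : Option A × Bool) :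
    Near (twistRels u v) (S.length * (2 * ℓ * n + 1)) (2 * ℓ * n + 2 * ℓ + 4 + S.length)
      (stableHom (FreeGroup.mk S) * baseHom (FreeGroup.mk [z]) *
        (stableHom (FreeGroup.mk S))⁻¹)
      (baseHom (twistAct u v (FreeGroup.mk S) (FreeGroup.mk [z]))) := by
  induction S with
  | nil =>
    rw [← FreeGroup.one_eq_mk (α := K)]
    simpa using (Near.refl (rels := twistRels u v) (baseHom (FreeGroup.mk [z]))).mono
      le_rfl (Nat.zero_le _)
  | cons τ S ih =>
    rw [List.length_cons] at hS
    have key : FreeGroup.mk (τ :: S) = FreeGroup.mk [τ] * FreeGroup.mk S := by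
      simp [FreeGroup.mul_mk]
    rw [key, map_mul, map_mul, MulAut.mul_apply]
    have hs1 : (stableHom (A := A) (FreeGroup.mk [τ])).norm ≤ 1 :=
      (norm_stableHom_le _).trans FreeGroup.norm_mk_le
    have h1 := (ih (by omega)).conj hs1
    set g := twistAct u v (FreeGroup.mk S) (FreeGroup.mk [z]) with hg
    have hgn : g.toWord.length ≤ 2 * ℓ * n + 1 := by
      refine (norm_twistAct_letter_le hu hv S z).trans ?_
      gcongr
      omega
    have h2 := near_letter_word hu hv τ g.toWord
    rw [FreeGroup.mk_toWord] at h2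
    have h3 := h1.trans (h2.mono hgn (M' := 2 * ℓ * n + 2 * ℓ + 4 + S.length + 1)
      (by generalize 2 * ℓ * n = B at *; omega))
    refine Near.mono (by simpa [mul_assoc] using h3) ?_ ?_
    · rw [List.length_cons]
      exact le_of_eq (by ring)
    · rw [List.length_cons]
      have := mul_assoc 2 ℓ n
      omega

theorem near_normalForm (hu : ∀ k, (u k).norm ≤ ℓ) (hv : ∀ k, (v k).norm ≤ ℓ)
    (n : ℕ) (w : Word (Option (A ⊕ K))) (hw : w.length ≤ n) :
    ∃ S : List (K × Bool), S.length ≤ w.length ∧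
      (toSemidirect u v (FreeGroup.mk w)).right = FreeGroup.mk S ∧
      Near (twistRels u v) (w.length * (n * (2 * ℓ * n + 1)))
        (2 * ℓ * n + 2 * ℓ + 4 + 3 * n) (FreeGroup.mk w)
        (baseHom (toSemidirect u v (FreeGroup.mk w)).left *
          stableHom (toSemidirect u v (FreeGroup.mk w)).right) := by
  induction w using List.reverseRecOn with
  | nil =>
    refine ⟨[], le_rfl, by simp [← FreeGroup.one_eq_mk], ?_⟩
    rw [← FreeGroup.one_eq_mk]
    simpa using (Near.refl (rels := twistRels u v) 1).mono le_rfl (Nat.zero_le _)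
  | append_singleton w y ih =>
    rw [List.length_append, List.length_singleton] at hw
    obtain ⟨S, hS, hr, h⟩ := ih (by omega)
    rw [← FreeGroup.mul_mk]
    have base : ∀ z : Option A × Bool,
        FreeGroup.mk [y] = baseHom (FreeGroup.mk [z]) → ∃ S : List (K × Bool),
        S.length ≤ (w ++ [y]).length ∧
        (toSemidirect u v (FreeGroup.mk w * FreeGroup.mk [y])).right = FreeGroup.mk S ∧
        Near (twistRels u v) ((w ++ [y]).length * (n * (2 * ℓ * n + 1)))
          (2 * ℓ * n + 2 * ℓ + 4 + 3 * n) (FreeGroup.mk w * FreeGroup.mk [y])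
          (baseHom (toSemidirect u v (FreeGroup.mk w * FreeGroup.mk [y])).left *
            stableHom (toSemidirect u v (FreeGroup.mk w * FreeGroup.mk [y])).right) := by
      intro z hz
      refine ⟨S, by simp; omega, by simp [hz, hr], ?_⟩
      rw [hz, map_mul, toSemidirect_baseHom, SemidirectProduct.mul_left,
        SemidirectProduct.mul_right, SemidirectProduct.left_inl, SemidirectProduct.right_inl,
        mul_one, hr, map_mul]
      rw [hr] at h
      have h1 := near_word_letter hu hv n S (by omega) z
      set b := baseHom (K := K) (toSemidirect u v (FreeGroup.mk w)).left
      set σ : FreeGroup (Option (A ⊕ K)) := stableHom (FreeGroup.mk S)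
      have hσn : σ.norm ≤ n :=
        ((norm_stableHom_le _).trans FreeGroup.norm_mk_le).trans (by omega)
      have hwn : (FreeGroup.mk w).norm ≤ n := FreeGroup.norm_mk_le.trans (by omega)
      have hc : (FreeGroup.mk w * σ⁻¹).norm ≤ 2 * n := by
        refine (FreeGroup.norm_mul_le _ _).trans ?_
        rw [FreeGroup.norm_inv_eq]
        omega
      have h2 : Near (twistRels u v) (w.length * (n * (2 * ℓ * n + 1)))
        (2 * ℓ * n + 2 * ℓ + 4 + 3 * n) (FreeGroup.mk w * σ⁻¹) b := by
        simpa [Near, mul_assoc] using h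
      have h3 := h2.mul (D := 2 * n)
        (h1.mono (M' := 2 * ℓ * n + 2 * ℓ + 4 + n)
          (Nat.mul_le_mul_right (2 * ℓ * n + 1) (show S.length ≤ n by omega)) (by omega))
        hc (by omega)
      have h4 := h3.mono (N' := (w ++ [y]).length * (n * (2 * ℓ * n + 1)))
        (M' := 2 * ℓ * n + 2 * ℓ + 4 + 3 * n)
        (by rw [List.length_append, List.length_singleton]; exact le_of_eq (by ring)) (by omega)
      simpa [Near, mul_assoc] using h4
    obtain ⟨z, b⟩ := y
    match z with
    | none => exact base (none, b) rfl
    | some (Sum.inl a) => exact base (some a, b) rfl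
    | some (Sum.inr k) =>
      have hz : (FreeGroup.mk [(some (Sum.inr k), b)] : FreeGroup (Option (A ⊕ K))) =
        stableHom (FreeGroup.mk [(k, b)]) := rfl
      refine ⟨S ++ [(k, b)], by simpa using hS, by simp [hz, hr, FreeGroup.mul_mk], ?_⟩
      have : Near (twistRels u v) (w.length * (n * (2 * ℓ * n + 1)))
          (2 * ℓ * n + 2 * ℓ + 4 + 3 * n)
          (FreeGroup.mk w * FreeGroup.mk [(some (Sum.inr k), b)])
          (baseHom (toSemidirect u v (FreeGroup.mk w *
            FreeGroup.mk [(some (Sum.inr k), b)])).left *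
          stableHom (toSemidirect u v (FreeGroup.mk w *
            FreeGroup.mk [(some (Sum.inr k), b)])).right) := by
        rw [hz]
        simpa [Near, mul_assoc] using h
      refine this.mono (Nat.mul_le_mul_right _ ?_) le_rfl
      simp

theorem filling_of_oneIn (hu : ∀ k, (u k).norm ≤ ℓ) (hv : ∀ k, (v k).norm ≤ ℓ)
    (n : ℕ) (w : Word (Option (A ⊕ K))) (hw : w.length ≤ n) (h : OneIn (twistRels u v) w) :
    Filling (twistRels u v) (n * (n * (2 * ℓ * n + 1))) (2 * ℓ * n + 2 * ℓ + 4 + 3 * n)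
      (FreeGroup.mk w) := by
  obtain ⟨_, _, _, h1⟩ := near_normalForm hu hv n w hw
  rw [toSemidirect_eq_one u v h] at h1
  refine Filling.mono (by simpa [Near] using h1) (Nat.mul_le_mul_right _ hw) le_rfl

theorem Filling.mem_normalClosure {X : Type} [DecidableEq X] {rels : Set (FreeGroup X)}
    {N M : ℕ} {g : FreeGroup X} (h : Filling rels N M g) : g ∈ Subgroup.normalClosure rels := by
  obtain ⟨L, -, h2, rfl⟩ := h
  refine Subgroup.list_prod_mem _ fun g hg => ?_
  obtain ⟨p, hp, rfl⟩ := List.mem_map.1 hg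
  have : p.2 ∈ Subgroup.normalClosure rels := by
    rcases (h2 p hp).2 with h | h
    · exact Subgroup.subset_normalClosure h
    · exact inv_mem_iff.1 (Subgroup.subset_normalClosure h)
  simpa using Subgroup.normalClosure_normal.conj_mem _ this p.1⁻¹

theorem oneIn_of_toSemidirect_eq_one (hu : ∀ k, (u k).norm ≤ ℓ) (hv : ∀ k, (v k).norm ≤ ℓ)
    (w : Word (Option (A ⊕ K))) (h : toSemidirect u v (FreeGroup.mk w) = 1) :
    OneIn (twistRels u v) w := by
  obtain ⟨_, _, _, h1⟩ := near_normalForm hu hv w.length w le_rfl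
  rw [h] at h1
  simpa [OneIn] using Filling.mem_normalClosure h1

end Upper

end FreeByFree

section UnitriangularFour

/-- Unitriangular integer matrices of size four, given by their entries above the diagonal:
`a, b, c` on the first superdiagonal, `d, e` on the second, and `f` in the corner. -/
@[ext]
structure Unitri where
  a : ℤ
  b : ℤ
  c : ℤ
  d : ℤ
  e : ℤ
  f : ℤ

namespace Unitri

instance : Mul Unitri :=
  ⟨fun x y => ⟨x.a + y.a, x.b + y.b, x.c + y.c, x.d + y.d + x.a * y.b, x.e + y.e + x.b * y.c,
    x.f + y.f + x.a * y.e + x.d * y.c⟩⟩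

instance : One Unitri := ⟨⟨0, 0, 0, 0, 0, 0⟩⟩

instance : Inv Unitri :=
  ⟨fun x => ⟨-x.a, -x.b, -x.c, -x.d + x.a * x.b, -x.e + x.b * x.c,
    -x.f - x.a * (-x.e + x.b * x.c) + x.d * x.c⟩⟩

theorem mul_def (x y : Unitri) : x * y = ⟨x.a + y.a, x.b + y.b, x.c + y.c,
    x.d + y.d + x.a * y.b, x.e + y.e + x.b * y.c, x.f + y.f + x.a * y.e + x.d * y.c⟩ := rfl

theorem one_def : (1 : Unitri) = ⟨0, 0, 0, 0, 0, 0⟩ := rfl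

theorem inv_def (x : Unitri) : x⁻¹ = ⟨-x.a, -x.b, -x.c, -x.d + x.a * x.b, -x.e + x.b * x.c,
    -x.f - x.a * (-x.e + x.b * x.c) + x.d * x.c⟩ := rfl

instance : Group Unitri := Group.ofLeftAxioms
  (fun x y z => by simp only [mul_def]; ext <;> dsimp only <;> ring)
  (fun x => by simp only [mul_def, one_def]; ext <;> dsimp only <;> ring)
  (fun x => by simp only [mul_def, one_def, inv_def]; ext <;> dsimp only <;> ring)

/-- The central element with corner entry `f`. -/
def corner (f : ℤ) : Unitri := ⟨0, 0, 0, 0, 0, f⟩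

theorem corner_mul_corner (f g : ℤ) : corner f * corner g = corner (f + g) := by
  simp [corner, mul_def]

theorem conj_corner (x : Unitri) (f : ℤ) : x * corner f * x⁻¹ = corner f := by
  simp only [corner, mul_def, inv_def]
  ext <;> dsimp only <;> ring

theorem corner_inv (f : ℤ) : (corner f)⁻¹ = corner (-f) := by
  simp [corner, inv_def]

theorem pow_a (n : ℕ) : (⟨1, 0, 0, 0, 0, 0⟩ : Unitri) ^ n = ⟨n, 0, 0, 0, 0, 0⟩ := by
  induction n with
  | zero => rfl
  | succ n ih => rw [pow_succ, ih]; simp [mul_def]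

theorem pow_b (n : ℕ) : (⟨0, 1, 0, 0, 0, 0⟩ : Unitri) ^ n = ⟨0, n, 0, 0, 0, 0⟩ := by
  induction n with
  | zero => rfl
  | succ n ih => rw [pow_succ, ih]; simp [mul_def]

theorem pow_c (n : ℕ) : (⟨0, 0, 1, 0, 0, 0⟩ : Unitri) ^ n = ⟨0, 0, n, 0, 0, 0⟩ := by
  induction n with
  | zero => rfl
  | succ n ih => rw [pow_succ, ih]; simp [mul_def]

end Unitri

/-- If a homomorphism sends each relator to a corner element with entry of absolute value at
most one, then areas of words are bounded below by the corner entries of their images. -/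
theorem AreaLE.natAbs_le {X : Type} {rels : Set (FreeGroup X)} (φ : FreeGroup X →* Unitri)
    (hφ : ∀ r ∈ rels, ∃ f : ℤ, f.natAbs ≤ 1 ∧ φ r = Unitri.corner f) {w : Word X} {m : ℕ}
    (h : AreaLE rels w m) {f : ℤ} (hf : φ (FreeGroup.mk w) = Unitri.corner f) :
    f.natAbs ≤ m := by
  obtain ⟨L, hL, hr, hprod⟩ := h
  have key : ∀ g ∈ L, ∃ f : ℤ, f.natAbs ≤ 1 ∧ φ g = Unitri.corner f := by
    intro g hg
    obtain ⟨x, r, h, rfl⟩ := hr g hg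
    rcases h with h | h
    · obtain ⟨f, h1, h2⟩ := hφ r h
      exact ⟨f, h1, by simp [h2, Unitri.conj_corner]⟩
    · obtain ⟨f, h1, h2⟩ := hφ _ h
      refine ⟨-f, by simpa using h1, ?_⟩
      rw [map_inv, inv_eq_iff_eq_inv, Unitri.corner_inv] at h2
      simp [h2, Unitri.conj_corner]
  have main : ∃ f : ℤ, f.natAbs ≤ L.length ∧ φ L.prod = Unitri.corner f := by
    clear hprod hr hL
    induction L with
    | nil => exact ⟨0, by simp, by simp [Unitri.corner, Unitri.one_def]⟩
    | cons g L ih =>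
      obtain ⟨f, h1, h2⟩ := ih fun g hg => key g (List.mem_cons_of_mem _ hg)
      obtain ⟨f', h1', h2'⟩ := key g List.mem_cons_self
      refine ⟨f' + f, ?_, by simp [h2, h2', Unitri.corner_mul_corner]⟩
      rw [List.length_cons]
      omega
  obtain ⟨f', h1, h2⟩ := main
  rw [hprod, hf, Unitri.corner, Unitri.corner, Unitri.mk.injEq] at h2
  rw [h2.2.2.2.2.2]
  omega

end UnitriangularFour

section MillerGroup

variable {A J : Type}

/-- Left twisting words of Miller's group. -/
def millerLeft : Bool ⊕ J ⊕ A → FreeGroup (Option A)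
  | .inl _ => 1
  | .inr (.inl _) => 1
  | .inr (.inr a) => (FreeGroup.of (some a))⁻¹

/-- Right twisting words of Miller's group built from the relators `rs j`; the two extra stable
letters fix `q`, respectively send `q` to `q x` for the extra letter `x = none`. -/
def millerRight (rs : J → FreeGroup A) : Bool ⊕ J ⊕ A → FreeGroup (Option A)
  | .inl b => cond b (FreeGroup.of none) 1
  | .inr (.inl j) => FreeGroup.map some (rs j)
  | .inr (.inr a) => FreeGroup.of (some a)

/-- The alphabet of Miller's group. -/
abbrev MillerGen (A J : Type) : Type := Option (Option A ⊕ (Bool ⊕ J ⊕ A))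

/-- The relators of Miller's group of the presentation `⟨A | rs⟩`. -/
def millerRels (rs : J → FreeGroup A) : Set (FreeGroup (MillerGen A J)) :=
  twistRels millerLeft (millerRight rs)

/-- The representation used to bound areas from below. -/
def millerRep : FreeGroup (MillerGen A J) →* Unitri :=
  FreeGroup.lift fun z => match z with
    | none => ⟨0, 0, 1, 0, 0, 0⟩
    | some (.inl none) => ⟨0, 0, 0, 0, 1, 0⟩
    | some (.inl (some _)) => 1
    | some (.inr (.inl false)) => ⟨1, 0, 0, 0, 0, 0⟩
    | some (.inr (.inl true)) => ⟨0, 1, 0, 0, 0, 0⟩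
    | some (.inr (.inr _)) => 1

theorem millerRep_some_some (w : FreeGroup A) :
    millerRep (J := J) (baseHom (FreeGroup.map some (FreeGroup.map some w))) = 1 := by
  have : (((millerRep (A := A) (J := J)).comp baseHom).comp (FreeGroup.map some)).comp
      (FreeGroup.map some) = 1 := by
    ext a : 1
    simp [millerRep, baseHom]
  exact DFunLike.congr_fun this w

theorem millerRep_rels (rs : J → FreeGroup A) :
    ∀ r ∈ millerRels rs, ∃ f : ℤ, f.natAbs ≤ 1 ∧ millerRep r = Unitri.corner f := by
  rintro _ ⟨⟨⟨k, b⟩, z⟩, rfl⟩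
  have hm := millerRep_some_some (A := A) (J := J)
  have hone : Unitri.corner 0 = 1 := rfl
  have hx : millerRep (A := A) (J := J) (baseHom (FreeGroup.of (some none))) =
    ⟨0, 0, 0, 0, 1, 0⟩ := by simp [millerRep, baseHom]
  have hxs : ∀ a, millerRep (A := A) (J := J) (baseHom (FreeGroup.of (some (some a)))) =
    1 := by simp [millerRep, baseHom]
  have hq : millerRep (A := A) (J := J) (baseHom (FreeGroup.of none)) =
    ⟨0, 0, 1, 0, 0, 0⟩ := by simp [millerRep, baseHom]
  have ht : millerRep (A := A) (J := J) (stableHom (FreeGroup.of (.inl false))) =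
    ⟨1, 0, 0, 0, 0, 0⟩ := by simp [millerRep, stableHom]
  have hd : millerRep (A := A) (J := J) (stableHom (FreeGroup.of (.inl true))) =
    ⟨0, 1, 0, 0, 0, 0⟩ := by simp [millerRep, stableHom]
  have hs : ∀ k, millerRep (A := A) (J := J) (stableHom (FreeGroup.of (.inr k))) = 1 := by
    simp [millerRep, stableHom]
  cases b
  · have hk : (FreeGroup.mk [(k, false)] : FreeGroup (Bool ⊕ J ⊕ A)) = (FreeGroup.of k)⁻¹ := by
      simp [FreeGroup.of, FreeGroup.inv_mk, FreeGroup.invRev]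
    simp only [twistRelator, hk, twistAct_of_inv]
    match k, z with
    | .inl false, none => exact ⟨0, by simp, by simp [millerLeft, millerRight, hq, ht, Unitri.mul_def, Unitri.inv_def, Unitri.corner]⟩
    | .inl false, some none => exact ⟨-1, by simp, by simp [hx, ht, Unitri.mul_def, Unitri.inv_def, Unitri.corner]⟩
    | .inl true, none => exact ⟨0, by simp, by simp [millerLeft, millerRight, hq, hx, hd, Unitri.mul_def, Unitri.inv_def, Unitri.corner]⟩
    | .inl true, some none => exact ⟨0, by simp, by simp [hx, hd, Unitri.mul_def, Unitri.inv_def, Unitri.corner]⟩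
    | .inr (.inl j), none => exact ⟨0, by simp, by simp [millerLeft, millerRight, hq, hs, hm, hone]⟩
    | .inr (.inr a), none => exact ⟨0, by simp, by simp [millerLeft, millerRight, hq, hs, hxs, hone]⟩
    | .inr k, some none => exact ⟨0, by simp, by simp [hs, hone]⟩
    | k, some (some a) => exact ⟨0, by simp, by simp [hxs, hone]⟩
  · have hk : (FreeGroup.mk [(k, true)] : FreeGroup (Bool ⊕ J ⊕ A)) = FreeGroup.of k := rfl
    simp only [twistRelator, hk, twistAct_of]
    match k, z with
    | .inl false, none => exact ⟨0, by simp, by simp [millerLeft, millerRight, hq, ht, Unitri.mul_def, Unitri.inv_def, Unitri.corner]⟩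
    | .inl false, some none => exact ⟨1, by simp, by simp [hx, ht, Unitri.mul_def, Unitri.inv_def, Unitri.corner]⟩
    | .inl true, none => exact ⟨0, by simp, by simp [millerLeft, millerRight, hq, hx, hd, Unitri.mul_def, Unitri.inv_def, Unitri.corner]⟩
    | .inl true, some none => exact ⟨0, by simp, by simp [hx, hd, Unitri.mul_def, Unitri.inv_def, Unitri.corner]⟩
    | .inr (.inl j), none => exact ⟨0, by simp, by simp [millerLeft, millerRight, hq, hs, hm, hone]⟩
    | .inr (.inr a), none => exact ⟨0, by simp, by simp [millerLeft, millerRight, hq, hs, hxs, hone]⟩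
    | .inr k, some none => exact ⟨0, by simp, by simp [hs, hone]⟩
    | k, some (some a) => exact ⟨0, by simp, by simp [hxs, hone]⟩

/-- The commutator of `tⁿ` and `dⁿ qⁿ d⁻ⁿ`. -/
def cubicElement (n : ℕ) : FreeGroup (MillerGen A J) :=
  let t : FreeGroup (MillerGen A J) := stableHom (FreeGroup.of (Sum.inl false))
  let d : FreeGroup (MillerGen A J) := stableHom (FreeGroup.of (Sum.inl true))
  let q : FreeGroup (MillerGen A J) := baseHom (FreeGroup.of none)
  let y := d ^ n * q ^ n * (d ^ n)⁻¹
  t ^ n * y * (t ^ n)⁻¹ * y⁻¹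

theorem millerRep_cubicElement (n : ℕ) :
    millerRep (cubicElement (A := A) (J := J) n) = Unitri.corner ((n ^ 3 : ℕ) : ℤ) := by
  have hq : millerRep (A := A) (J := J) (baseHom (FreeGroup.of none)) =
    ⟨0, 0, 1, 0, 0, 0⟩ := by simp [millerRep, baseHom]
  have ht : millerRep (A := A) (J := J) (stableHom (FreeGroup.of (.inl false))) =
    ⟨1, 0, 0, 0, 0, 0⟩ := by simp [millerRep, stableHom]
  have hd : millerRep (A := A) (J := J) (stableHom (FreeGroup.of (.inl true))) =
    ⟨0, 1, 0, 0, 0, 0⟩ := by simp [millerRep, stableHom]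
  simp only [cubicElement, map_mul, map_pow, map_inv, hq, ht, hd,
    Unitri.pow_a, Unitri.pow_b, Unitri.pow_c, Unitri.mul_def, Unitri.inv_def, Unitri.corner]
  ext <;> dsimp only <;> push_cast <;> ring

theorem toSemidirect_cubicElement (rs : J → FreeGroup A) (n : ℕ) :
    toSemidirect millerLeft (millerRight rs) (cubicElement n) = 1 := by
  have ht : twistAct millerLeft (millerRight rs) (FreeGroup.of (.inl false)) = 1 := by
    ext z : 1
    simp [twistAct_of, millerLeft, millerRight]
  rw [cubicElement, map_mul, map_inv, mul_inv_eq_one]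
  simp only [map_mul, map_pow, map_inv, toSemidirect_stableHom, toSemidirect_baseHom]
  rw [← map_pow, ← map_pow, ← map_pow, ← map_inv, ← SemidirectProduct.inl_aut, ← map_inv,
    ← SemidirectProduct.inl_aut, map_pow, ht, one_pow, MulAut.one_apply]

section

variable [DecidableEq A] [DecidableEq J]

theorem norm_freeGroup_pow_le {X : Type} [DecidableEq X] (g : FreeGroup X) (n : ℕ) :
    (g ^ n).norm ≤ n * g.norm := by
  induction n with
  | zero => simp
  | succ n ih =>
    rw [pow_succ, add_mul, one_mul]
    exact (FreeGroup.norm_mul_le _ _).trans (Nat.add_le_add_right ih _)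

theorem norm_cubicElement_le (n : ℕ) : (cubicElement (A := A) (J := J) n).norm ≤ 8 * n := by
  have hq := norm_freeGroup_pow_le (baseHom (FreeGroup.of none) : FreeGroup (MillerGen A J)) n
  have ht := norm_freeGroup_pow_le
    (stableHom (FreeGroup.of (.inl false)) : FreeGroup (MillerGen A J)) n
  have hd := norm_freeGroup_pow_le (stableHom (FreeGroup.of (.inl true)) : FreeGroup (MillerGen A J)) n
  simp only [baseHom, stableHom, FreeGroup.map.of, FreeGroup.norm_of, mul_one] at hq ht hd
  simp only [cubicElement, baseHom, stableHom, FreeGroup.map.of]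
  set q := FreeGroup.of (Option.map Sum.inl (none : Option (Option A))) ^ n with hq'
  set t : FreeGroup (MillerGen A J) := FreeGroup.of (some (.inr (.inl false))) ^ n
  set d : FreeGroup (MillerGen A J) := FreeGroup.of (some (.inr (.inl true))) ^ n
  have h1 := FreeGroup.norm_mul_le (t * (d * q * d⁻¹) * t⁻¹) (d * q * d⁻¹)⁻¹
  have h2 := FreeGroup.norm_mul_le (t * (d * q * d⁻¹)) t⁻¹
  have h3 := FreeGroup.norm_mul_le t (d * q * d⁻¹)
  have h4 := FreeGroup.norm_mul_le (d * q) d⁻¹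
  have h5 := FreeGroup.norm_mul_le d q
  rw [FreeGroup.norm_inv_eq] at h1 h2 h4
  omega

end

theorem exists_norm_bound [Finite A] [Finite J] [DecidableEq A] (rs : J → FreeGroup A) :
    ∃ ℓ, (∀ k, (millerLeft (J := J) (A := A) k).norm ≤ ℓ) ∧
      ∀ k, (millerRight rs k).norm ≤ ℓ := by
  obtain ⟨ℓ, h⟩ := (Set.finite_range fun k => (millerLeft (J := J) (A := A) k).norm).bddAbove
  obtain ⟨ℓ', h'⟩ := (Set.finite_range fun k => (millerRight rs k).norm).bddAbove
  exact ⟨max ℓ ℓ', fun k => (h ⟨k, rfl⟩).trans (le_max_left _ _),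
    fun k => (h' ⟨k, rfl⟩).trans (le_max_right _ _)⟩

theorem exists_isoperimetric_miller [Finite A] [Finite J] (rs : J → FreeGroup A) :
    ∃ C, IsIsoperimetric (millerRels rs) fun n => C * n ^ 3 := by
  classical
  obtain ⟨ℓ, hu, hv⟩ := exists_norm_bound rs
  refine ⟨2 * ℓ + 1, fun n w hw h1 => ?_⟩
  have := (filling_of_oneIn hu hv n w hw h1).mono (N' := (2 * ℓ + 1) * n ^ 3) (by
    rcases Nat.eq_zero_or_pos n with rfl | hn
    · simp
    · calc n * (n * (2 * ℓ * n + 1)) ≤ n * (n * (2 * ℓ * n + n)) := by gcongr; exact hn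
        _ = (2 * ℓ + 1) * n ^ 3 := by ring) le_rfl
  exact this.areaLE

theorem exists_isodiametric_miller [Finite A] [Finite J] (rs : J → FreeGroup A) :
    ∃ C, IsIsodiametric (millerRels rs) fun n => C * n + C := by
  classical
  obtain ⟨ℓ, hu, hv⟩ := exists_norm_bound rs
  refine ⟨2 * ℓ + 4, fun n w hw h1 => ?_⟩
  have := (filling_of_oneIn hu hv n w hw h1).mono (M' := (2 * ℓ + 4) * n + (2 * ℓ + 4)) le_rfl
    (by nlinarith)
  exact this.diamLE

theorem cube_le_isoperimetric_miller [Finite A] [Finite J] (rs : J → FreeGroup A) {f : ℕ → ℕ}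
    (hf : IsIsoperimetric (millerRels rs) f) (n : ℕ) : n ^ 3 ≤ f (8 * n) := by
  classical
  obtain ⟨ℓ, hu, hv⟩ := exists_norm_bound rs
  have h1 : OneIn (millerRels rs) (cubicElement n).toWord :=
    oneIn_of_toSemidirect_eq_one hu hv _
      (by rw [FreeGroup.mk_toWord, toSemidirect_cubicElement])
  have h2 := hf (8 * n) _ (norm_cubicElement_le n) h1
  have h3 := h2.natAbs_le millerRep (millerRep_rels rs)
    (by rw [FreeGroup.mk_toWord, millerRep_cubicElement])
  simpa using h3

end MillerGroup

section MillerConjugacy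

variable {A J : Type}

/-- The inclusion of the free group on `A` into the alphabet of Miller's group. -/
def millerWord : FreeGroup A →* FreeGroup (MillerGen A J) :=
  (baseHom.comp (FreeGroup.map some)).comp (FreeGroup.map some)

theorem isConj_twist {A K : Type} (u v : K → FreeGroup A) (k : K) (g : FreeGroup (Option A)) :
    IsConj (QuotientGroup.mk' (Subgroup.normalClosure (twistRels u v)) (baseHom g))
      (QuotientGroup.mk' (Subgroup.normalClosure (twistRels u v))
        (baseHom (twistHom (u k) (v k) g))) := by
  set π := QuotientGroup.mk' (Subgroup.normalClosure (twistRels u v))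
  set s := π (stableHom (FreeGroup.of k))
  have : (MulAut.conj s).toMonoidHom.comp (π.comp baseHom) =
      (π.comp baseHom).comp (twistHom (u k) (v k)) := by
    ext z : 1
    have h : twistRelator u v (k, true) z ∈ Subgroup.normalClosure (twistRels u v) :=
      Subgroup.subset_normalClosure ⟨((k, true), z), rfl⟩
    have h' : π (twistRelator u v (k, true) z) = 1 := (QuotientGroup.eq_one_iff _).2 h
    have hk : (FreeGroup.mk [(k, true)] : FreeGroup K) = FreeGroup.of k := rfl
    simp only [twistRelator, hk, twistAct_of, map_mul, map_inv] at h'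
    simpa [mul_inv_eq_one] using h'
  exact isConj_iff.2 ⟨s, DFunLike.congr_fun this g⟩

theorem isConj_miller_iff (rs : J → FreeGroup A) (w : FreeGroup A) :
    IsConj (QuotientGroup.mk' (Subgroup.normalClosure (millerRels rs))
        (FreeGroup.of none * millerWord w))
      (QuotientGroup.mk' (Subgroup.normalClosure (millerRels rs)) (FreeGroup.of none)) ↔
      w ∈ Subgroup.normalClosure (Set.range rs) := by
  have hq : (FreeGroup.of none : FreeGroup (MillerGen A J)) = baseHom (FreeGroup.of none) := by
    simp [baseHom]
  set π := QuotientGroup.mk' (Subgroup.normalClosure (millerRels rs)) with hπ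
  constructor
  · intro h
    set N := Subgroup.normalClosure (Set.range rs)
    let ρ : FreeGroup (MillerGen A J) →* FreeGroup A ⧸ N :=
      FreeGroup.lift fun z => match z with
        | some (.inl (some a)) => QuotientGroup.mk' N (FreeGroup.of a)
        | _ => 1
    have hw : ∀ w, ρ (millerWord w) = QuotientGroup.mk' N w := by
      intro w
      have : ρ.comp millerWord = QuotientGroup.mk' N := by
        ext a : 1
        simp [ρ, millerWord, baseHom]
      exact DFunLike.congr_fun this w
    have hs : ∀ g, ρ (stableHom g) = 1 := by
      intro g
      have : ρ.comp stableHom = 1 := by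
        ext a : 1
        simp [ρ, stableHom]
      exact DFunLike.congr_fun this g
    have hrs : ∀ j, QuotientGroup.mk' N (rs j) = 1 := fun j =>
      (QuotientGroup.eq_one_iff _).2 (Subgroup.subset_normalClosure ⟨j, rfl⟩)
    have hb : ∀ k, (ρ.comp baseHom).comp (twistHom (millerLeft k) (millerRight rs k)) =
        ρ.comp baseHom := by
      intro k
      ext z : 1
      have hqz : ρ (baseHom (FreeGroup.of none)) = 1 := by simp [ρ, baseHom]
      have hxz : ρ (baseHom (FreeGroup.of (some none))) = 1 := by simp [ρ, baseHom]
      have hmw : ∀ w : FreeGroup A, ρ (baseHom (FreeGroup.map some (FreeGroup.map some w))) =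
        QuotientGroup.mk' N w := hw
      match k, z with
      | _, some z => simp
      | .inl true, none => simp [millerLeft, millerRight, hqz, hxz]
      | .inl false, none => simp [millerLeft, millerRight, hqz]
      | .inr (.inl j), none =>
        simpa [millerLeft, millerRight, hqz, hmw] using hrs j
      | .inr (.inr a), none => simp [millerLeft, millerRight, hqz]
    have hb' : ∀ (τ : (Bool ⊕ J ⊕ A) × Bool) g,
        ρ (baseHom (twistAct millerLeft (millerRight rs) (FreeGroup.mk [τ]) g)) =
        ρ (baseHom g) := by
      rintro ⟨k, _ | _⟩ g
      · have hk : (FreeGroup.mk [(k, false)] : FreeGroup (Bool ⊕ J ⊕ A)) =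
            (FreeGroup.of k)⁻¹ := by simp [FreeGroup.of, FreeGroup.inv_mk, FreeGroup.invRev]
        rw [hk]
        have := DFunLike.congr_fun (hb k)
          (twistAct millerLeft (millerRight rs) (FreeGroup.of k)⁻¹ g)
        simp only [MonoidHom.comp_apply] at this
        rw [← this, ← twistAct_of, ← MulAut.mul_apply, ← map_mul, mul_inv_cancel, map_one,
          MulAut.one_apply]
      · exact (congrArg (fun g => ρ (baseHom g)) (twistAct_of _ _ k g)).trans
          (DFunLike.congr_fun (hb k) g)
    have hle : Subgroup.normalClosure (millerRels rs) ≤ ρ.ker := by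
      refine Subgroup.normalClosure_le_normal ?_
      rintro _ ⟨⟨τ, z⟩, rfl⟩
      change ρ (twistRelator _ _ τ z) = 1
      simp only [twistRelator, map_mul, map_inv, hs, hb']
      simp
    have h1 := (QuotientGroup.lift _ ρ hle).map_isConj h
    simp only [hπ, QuotientGroup.coe_mk', QuotientGroup.lift_mk, map_mul, hw] at h1
    have hq1 : ρ (FreeGroup.of none) = 1 := by simp [ρ]
    rw [hq1, one_mul, isConj_one_left] at h1
    exact (QuotientGroup.eq_one_iff _).1 h1
  · have hT : ∀ (k : Bool ⊕ J ⊕ A) (z : FreeGroup A),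
        IsConj (π (FreeGroup.of none * millerWord z))
          (π (baseHom (FreeGroup.map some (millerLeft k)) * FreeGroup.of none *
            baseHom (FreeGroup.map some (millerRight rs k)) * millerWord z)) := by
      intro k z
      have := isConj_twist millerLeft (millerRight rs) k
        (FreeGroup.of none * FreeGroup.map some (FreeGroup.map some z))
      simp only [map_mul, twistHom_of_none, twistHom_map_some, ← hq] at this
      simp only [map_mul]
      exact this
    let H : Subgroup (FreeGroup A) :=
      { carrier := {x | ∀ z, IsConj (π (FreeGroup.of none * millerWord z))
          (π (FreeGroup.of none * millerWord (x * z * x⁻¹)))}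
        one_mem' := fun z => by
          simp only [one_mul, inv_one, mul_one]
          exact IsConj.refl _
        mul_mem' := fun {x y} hx hy z => by
          have := (hy z).trans (hx _)
          rw [mul_inv_rev]
          simpa only [mul_assoc] using this
        inv_mem' := fun {x} hx z => by
          have := (hx (x⁻¹ * z * x⁻¹⁻¹)).symm
          have e : x * (x⁻¹ * z * x⁻¹⁻¹) * x⁻¹ = z := by group
          rwa [e] at this }
    have hH : ∀ x, x ∈ H := by
      have : H = ⊤ := by
        rw [eq_top_iff, ← FreeGroup.closure_range_of, Subgroup.closure_le]
        rintro _ ⟨a, rfl⟩ z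
        refine (hT (.inr (.inr a)) z).trans (isConj_iff.2 ⟨π (millerWord (FreeGroup.of a)), ?_⟩)
        have ha : baseHom (FreeGroup.of (some (some a))) =
          millerWord (J := J) (FreeGroup.of a) := by simp [millerWord]
        simp only [millerLeft, millerRight, map_inv, FreeGroup.map.of, ha, map_mul]
        group
      exact fun x => this ▸ Subgroup.mem_top x
    let P : Subgroup (FreeGroup A) :=
      { carrier := {n | ∀ z, IsConj (π (FreeGroup.of none * millerWord (n * z)))
          (π (FreeGroup.of none * millerWord z))}
        one_mem' := fun z => by
          rw [one_mul]
        mul_mem' := fun {x y} hx hy z => by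
          rw [mul_assoc]
          exact (hx _).trans (hy z)
        inv_mem' := fun {x} hx z => by
          have := (hx (x⁻¹ * z)).symm
          rwa [mul_inv_cancel_left] at this }
    have hP : P.Normal := ⟨fun n hn x z => by
      have h1 := (hH x⁻¹ (x * n * x⁻¹ * z))
      have h2 := hn (x⁻¹ * z * x)
      have h3 := (hH x⁻¹ z).symm
      rw [inv_inv] at h1 h3
      have e : x⁻¹ * (x * n * x⁻¹ * z) * x = n * (x⁻¹ * z * x) := by group
      rw [e] at h1
      exact (h1.trans h2).trans h3⟩
    have hle : Subgroup.normalClosure (Set.range rs) ≤ P := by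
      refine Subgroup.normalClosure_le_normal ?_
      rintro _ ⟨j, rfl⟩ z
      refine IsConj.symm ?_
      have hj : baseHom (FreeGroup.map some (FreeGroup.map some (rs j))) =
          millerWord (J := J) (rs j) := by simp [millerWord]
      simpa only [millerLeft, millerRight, map_one, one_mul, hj, map_mul, mul_assoc]
        using hT (.inr (.inl j)) z
    intro hw
    simpa using hle hw 1

end MillerConjugacy

section AffineMachines

/-- A rule replacing `mul * u + add` in state `src` by `mul' * u + add'` in state `dst`. -/
structure AffineRule (ι S : Type) where
  src : S
  dst : S
  mul : ι → ℕ
  add : ι → ℕ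
  mul' : ι → ℕ
  add' : ι → ℕ

variable {ι S I : Type} [Fintype ι]

/-- Ordered product of powers. -/
noncomputable def multiPow {G : Type} [Monoid G] (g : ι → G) (c : ι → ℕ) : G :=
  (Finset.univ.toList.map fun j => g j ^ c j).prod

theorem map_multiPow {G G' : Type} [Monoid G] [Monoid G'] (φ : G →* G') (g : ι → G)
    (c : ι → ℕ) : φ (multiPow g c) = multiPow (fun j => φ (g j)) c := by
  simp [multiPow, map_list_prod, Function.comp_def]

theorem multiPow_mul {G : Type} [Monoid G] (g : ι → G) (m u : ι → ℕ) :
    multiPow g (m * u) = multiPow (fun j => g j ^ m j) u := by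
  simp [multiPow, pow_mul]

theorem multiPow_add {G : Type} [Monoid G] (g : ι → G) (hg : ∀ i j, Commute (g i) (g j))
    (c c' : ι → ℕ) : multiPow g (c + c') = multiPow g c * multiPow g c' := by
  unfold multiPow
  induction (Finset.univ : Finset ι).toList with
  | nil => simp
  | cons j l ih =>
    have h : Commute (g j ^ c' j) (l.map fun j => g j ^ c j).prod := by
      refine Commute.list_prod_right _ _ fun y hy => ?_
      obtain ⟨i, -, rfl⟩ := List.mem_map.1 hy
      exact (hg j i).pow_pow _ _
    rw [List.map_cons, List.prod_cons, ih, List.map_cons, List.prod_cons, List.map_cons,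
      List.prod_cons, Pi.add_apply, pow_add]
    rw [mul_assoc, mul_assoc, ← mul_assoc (g j ^ c' j), h.eq, mul_assoc]

/-- The alphabet of the group of a system of affine rules. -/
abbrev MachineGen (ι S I : Type) : Type := ι ⊕ S ⊕ I ⊕ Unit

namespace MachineGen

/-- Counter letters. -/
def x (j : ι) : FreeGroup (MachineGen ι S I) := FreeGroup.of (.inl j)

/-- State letters. -/
def t (s : S) : FreeGroup (MachineGen ι S I) := FreeGroup.of (.inr (.inl s))

/-- Rule letters. -/
def r (i : I) : FreeGroup (MachineGen ι S I) := FreeGroup.of (.inr (.inr (.inl i)))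

/-- The testing letter. -/
def κ : FreeGroup (MachineGen ι S I) := FreeGroup.of (.inr (.inr (.inr ())))

/-- The element coding a configuration. -/
noncomputable def cfg (s : S) (c : ι → ℕ) : FreeGroup (MachineGen ι S I) :=
  multiPow x c * t s * (multiPow x c)⁻¹

/-- The commutator of the testing letter with the code of a configuration. -/
noncomputable def test (s : S) (c : ι → ℕ) : FreeGroup (MachineGen ι S I) :=
  κ * cfg s c * κ⁻¹ * (cfg s c)⁻¹

end MachineGen

open MachineGen

/-- The relators of the group of a system of affine rules with accepting configuration
`(s₀, c₀)`. -/
noncomputable def machineRel (rule : I → AffineRule ι S) (s₀ : S) (c₀ : ι → ℕ) :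
    (ι × ι) ⊕ (I × ι) ⊕ I ⊕ I ⊕ Unit → FreeGroup (MachineGen ι S I)
  | .inl (i, j) => x i * x j * (x i)⁻¹ * (x j)⁻¹
  | .inr (.inl (i, j)) =>
    r i * x j ^ (rule i).mul j * (r i)⁻¹ * (x j ^ (rule i).mul' j)⁻¹
  | .inr (.inr (.inl i)) =>
    r i * cfg (rule i).src (rule i).add * (r i)⁻¹ * (cfg (rule i).dst (rule i).add')⁻¹
  | .inr (.inr (.inr (.inl i))) => κ * r i * κ⁻¹ * (r i)⁻¹
  | .inr (.inr (.inr (.inr ()))) => test s₀ c₀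

variable {rule : I → AffineRule ι S} {s₀ : S} {c₀ : ι → ℕ}

theorem mul_mul_inv_mul_inv_eq_one_iff {G : Type*} [Group G] {a b : G} :
    a * b * a⁻¹ * b⁻¹ = 1 ↔ Commute a b := by
  rw [mul_inv_eq_one, mul_inv_eq_iff_eq_mul, commute_iff_eq]

theorem machine_rule_iff (i : I) (u : ι → ℕ) :
    test (rule i).src ((rule i).mul * u + (rule i).add) ∈
        Subgroup.normalClosure (Set.range (machineRel rule s₀ c₀)) ↔
      test (rule i).dst ((rule i).mul' * u + (rule i).add') ∈
        Subgroup.normalClosure (Set.range (machineRel rule s₀ c₀)) := by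
  set N := Subgroup.normalClosure (Set.range (machineRel rule s₀ c₀))
  set π := QuotientGroup.mk' N
  have hrel : ∀ j, π (machineRel rule s₀ c₀ j) = 1 := fun j =>
    (QuotientGroup.eq_one_iff _).2 (Subgroup.subset_normalClosure ⟨j, rfl⟩)
  have hx : ∀ i j, Commute (π (x i)) (π (x j)) := fun i j => by
    have := hrel (.inl (i, j))
    simp only [machineRel, map_mul, map_inv, mul_mul_inv_mul_inv_eq_one_iff] at this
    exact this
  have hrx : ∀ j, π (r i) * π (x j) ^ (rule i).mul j * (π (r i))⁻¹ =
      π (x j) ^ (rule i).mul' j := fun j => by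
    have := hrel (.inr (.inl (i, j)))
    simpa only [machineRel, map_mul, map_inv, map_pow, mul_inv_eq_one] using this
  have hrc : π (r i) * π (cfg (rule i).src (rule i).add) * (π (r i))⁻¹ =
      π (cfg (rule i).dst (rule i).add') := by
    have := hrel (.inr (.inr (.inl i)))
    simpa only [machineRel, map_mul, map_inv, mul_inv_eq_one] using this
  have hκ : Commute (π κ) (π (r i)) := by
    have := hrel (.inr (.inr (.inr (.inl i))))
    simp only [machineRel, map_mul, map_inv, mul_mul_inv_mul_inv_eq_one_iff] at this
    exact this
  have hX : ∀ c c', π (multiPow x (c + c')) = π (multiPow x c) * π (multiPow x c') := by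
    intro c c'
    simp only [map_multiPow]
    exact multiPow_add _ hx c c'
  have hC : ∀ s c c', π (cfg s (c + c')) = π (multiPow x c) * π (cfg s c') *
      (π (multiPow x c))⁻¹ := by
    intro s c c'
    simp only [cfg, map_mul, map_inv, hX]
    group
  have hR : π (r i) * π (multiPow x ((rule i).mul * u)) * (π (r i))⁻¹ =
      π (multiPow x ((rule i).mul' * u)) := by
    rw [map_multiPow, map_multiPow, multiPow_mul, multiPow_mul, ← MulAut.conj_apply,
      ← MulEquiv.coe_toMonoidHom, map_multiPow]
    congr 1
    funext j
    exact hrx j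
  have key : π (r i) * π (cfg (rule i).src ((rule i).mul * u + (rule i).add)) * (π (r i))⁻¹ =
      π (cfg (rule i).dst ((rule i).mul' * u + (rule i).add')) := by
    rw [hC, hC, ← hR, ← hrc]
    group
  have hmem : ∀ s c, test s c ∈ N ↔ Commute (π κ) (π (cfg s c)) := by
    intro s c
    rw [← QuotientGroup.eq_one_iff, ← QuotientGroup.mk'_apply, test, map_mul, map_mul, map_mul,
      map_inv, map_inv, mul_mul_inv_mul_inv_eq_one_iff]
  rw [hmem, hmem, ← key]
  constructor
  · exact fun h => (hκ.mul_right h).mul_right hκ.inv_right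
  · intro h
    have := (hκ.inv_right.mul_right h).mul_right hκ
    simpa [mul_assoc] using this

theorem machine_start_mem :
    test s₀ c₀ ∈ Subgroup.normalClosure (Set.range (machineRel rule s₀ c₀)) :=
  Subgroup.subset_normalClosure ⟨.inr (.inr (.inr (.inr ()))), rfl⟩

end AffineMachines

section Model

variable {ι : Type}

/-- The points on which the model acts: pairs of a set and a point of a rational vector space. -/
abbrev ModelBase (ι : Type) : Type := Set (ι → ℚ) × (ι → ℚ)

/-- Permutations acting on the base only. -/
def baseAct : Equiv.Perm (ModelBase ι) →* Equiv.Perm (ModelBase ι × Fin 3) where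
  toFun g := g.prodCongr (Equiv.refl _)
  map_one' := rfl
  map_mul' _ _ := rfl

/-- Permutations acting on the fibres only. -/
def fibreAct : (ModelBase ι → Equiv.Perm (Fin 3)) →* Equiv.Perm (ModelBase ι × Fin 3) where
  toFun f := Equiv.prodShear (Equiv.refl _) f
  map_one' := rfl
  map_mul' _ _ := rfl

@[simp]
theorem baseAct_apply (g : Equiv.Perm (ModelBase ι)) (p : ModelBase ι × Fin 3) :
    baseAct g p = (g p.1, p.2) := rfl

@[simp]
theorem fibreAct_apply (f : ModelBase ι → Equiv.Perm (Fin 3)) (p : ModelBase ι × Fin 3) :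
    fibreAct f p = (p.1, f p.1 p.2) := rfl

theorem baseAct_conj (g : Equiv.Perm (ModelBase ι)) (f : ModelBase ι → Equiv.Perm (Fin 3)) :
    baseAct g * fibreAct f * (baseAct g)⁻¹ = fibreAct fun ω => f (g⁻¹ ω) := by
  rw [mul_inv_eq_iff_eq_mul]
  ext1 p
  simp [Equiv.Perm.mul_apply]

open Classical in
/-- A transposition on the fibre over one point. -/
noncomputable def lamp (ω : ModelBase ι) : Equiv.Perm (ModelBase ι × Fin 3) :=
  fibreAct fun ω' => if ω' = ω then Equiv.swap 0 1 else 1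

theorem baseAct_conj_lamp (g : Equiv.Perm (ModelBase ι)) (ω : ModelBase ι) :
    baseAct g * lamp ω * (baseAct g)⁻¹ = lamp (g ω) := by
  rw [lamp, baseAct_conj, lamp]
  congr 1
  funext ω'
  by_cases h : ω' = g ω
  · rw [if_pos (Equiv.Perm.inv_eq_iff_eq.2 h), if_pos h]
  · rw [if_neg (mt Equiv.Perm.inv_eq_iff_eq.1 h), if_neg h]

open Classical in
/-- A transposition on the fibres over the points `(E, y)` with `y ∉ E`. -/
noncomputable def tester : Equiv.Perm (ModelBase ι × Fin 3) :=
  fibreAct fun ω => if ω.2 ∈ ω.1 then 1 else Equiv.swap 1 2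

theorem tester_commute_baseAct {g : Equiv.Perm (ModelBase ι)}
    (hg : ∀ ω, (g ω).2 ∈ (g ω).1 ↔ ω.2 ∈ ω.1) : Commute tester (baseAct g) := by
  have : baseAct g * tester * (baseAct g)⁻¹ = tester := by
    rw [tester, baseAct_conj]
    congr 1
    funext ω
    have := hg (g⁻¹ ω)
    rw [← Equiv.Perm.mul_apply, mul_inv_cancel, Equiv.Perm.one_apply] at this
    by_cases h : ω.2 ∈ ω.1
    · rw [if_pos (this.1 h), if_pos h]
    · rw [if_neg (mt this.2 h), if_neg h]
  rw [mul_inv_eq_iff_eq_mul] at this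
  exact this.symm

theorem tester_commute_lamp_iff {ω : ModelBase ι} :
    Commute tester (lamp ω) ↔ ω.2 ∈ ω.1 := by
  constructor
  · intro h
    by_contra hω
    have := DFunLike.congr_fun h.eq (ω, 0)
    simp only [tester, lamp, Equiv.Perm.mul_apply, fibreAct_apply, if_true, if_neg hω] at this
    revert this
    simp only [Prod.mk.injEq, true_and]
    decide
  · intro hω
    rw [tester, lamp, commute_iff_eq, ← map_mul, ← map_mul]
    congr 1
    funext ω'
    by_cases h : ω' = ω
    · subst h
      simp [hω]
    · simp [h]

/-- Translation of the point. -/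
def pointShift : Multiplicative (ι → ℚ) →* Equiv.Perm (ModelBase ι) where
  toFun v := (Equiv.refl _).prodCongr (Equiv.addLeft v.toAdd)
  map_one' := by ext1 ω; ext1 <;> simp
  map_mul' v w := by ext1 ω; ext1 <;> simp [Equiv.Perm.mul_apply, add_assoc]

@[simp]
theorem pointShift_apply (v : Multiplicative (ι → ℚ)) (ω : ModelBase ι) :
    pointShift v ω = (ω.1, v.toAdd + ω.2) := rfl

theorem multiPow_single [Fintype ι] [DecidableEq ι] (c : ι → ℕ) :
    multiPow (fun j => Multiplicative.ofAdd (Pi.single j 1 : ι → ℚ)) c =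
      Multiplicative.ofAdd fun j => (c j : ℚ) := by
  rw [multiPow, Finset.prod_map_toList]
  simp only [← ofAdd_nsmul, ← ofAdd_sum]
  congr 1
  funext j
  simp [Finset.sum_apply, Pi.single_apply]

variable {S I : Type}

/-- The rational affine map underlying a rule. -/
def ruleAffine (R : AffineRule ι S) (h : ∀ j, 0 < R.mul j ∧ 0 < R.mul' j) :
    Equiv.Perm (ι → ℚ) where
  toFun y j := (y j - R.add j) / R.mul j * R.mul' j + R.add' j
  invFun y j := (y j - R.add' j) / R.mul' j * R.mul j + R.add j
  left_inv y := by
    funext j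
    have h1 := (h j).1.ne'
    have h2 := (h j).2.ne'
    field_simp
    ring
  right_inv y := by
    funext j
    have h1 := (h j).1.ne'
    have h2 := (h j).2.ne'
    field_simp
    ring

/-- The rational points of a set of integral points. -/
def ratSet (E : Set (ι → ℤ)) : Set (ι → ℚ) := (fun c j => (c j : ℚ)) '' E

theorem mem_ratSet {E : Set (ι → ℤ)} (c : ι → ℤ) :
    (fun j => (c j : ℚ)) ∈ ratSet E ↔ c ∈ E := by
  refine Function.Injective.mem_set_image fun c d h => ?_
  funext j
  exact_mod_cast congrFun h j

variable (H : S → Set (ι → ℤ)) (R : AffineRule ι S)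

/-- The integral points of the range of a rule. -/
def ruleLattice : Set (ι → ℚ) :=
  Set.range fun (u : ι → ℤ) j => (R.mul' j * u j + R.add' j : ℚ)

open Classical in
/-- The action of a rule on the base. -/
noncomputable def ruleAct (h : ∀ j, 0 < R.mul j ∧ 0 < R.mul' j) :
    Equiv.Perm (ModelBase ι) :=
  Equiv.prodCongrLeft (fun y => if y ∈ ruleLattice R then
      Equiv.swap (ruleAffine R h '' ratSet (H R.src)) (ratSet (H R.dst)) else 1) *
    (Equiv.Set.congr (ruleAffine R h)).prodCongr (ruleAffine R h)

variable {H R} (h : ∀ j, 0 < R.mul j ∧ 0 < R.mul' j)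

open Classical in
theorem ruleAct_apply (ω : ModelBase ι) : ruleAct H R h ω =
    ((if ruleAffine R h ω.2 ∈ ruleLattice R then
      Equiv.swap (ruleAffine R h '' ratSet (H R.src)) (ratSet (H R.dst)) else 1)
        (ruleAffine R h '' ω.1), ruleAffine R h ω.2) := rfl

theorem ruleAffine_apply (u : ι → ℤ) :
    ruleAffine R h (fun j => (R.mul j * u j + R.add j : ℤ)) =
      fun j => ((R.mul' j * u j + R.add' j : ℤ) : ℚ) := by
  funext j
  have h1 := (h j).1.ne'
  simp only [ruleAffine, Equiv.coe_fn_mk]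
  push_cast
  field_simp
  ring

theorem ruleAct_mem_iff (hH : ∀ u : ι → ℤ, (fun j => (R.mul j * u j + R.add j : ℤ)) ∈ H R.src ↔
    (fun j => (R.mul' j * u j + R.add' j : ℤ)) ∈ H R.dst) (ω : ModelBase ι) :
    (ruleAct H R h ω).2 ∈ (ruleAct H R h ω).1 ↔ ω.2 ∈ ω.1 := by
  classical
  rw [ruleAct_apply]
  dsimp only
  have h0 : ruleAffine R h ω.2 ∈ ruleAffine R h '' ω.1 ↔ ω.2 ∈ ω.1 :=
    (ruleAffine R h).injective.mem_set_image
  split_ifs with hΛ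
  · rw [← h0]
    obtain ⟨u, hu⟩ := hΛ
    have hu' : ruleAffine R h ω.2 = fun j => ((R.mul' j * u j + R.add' j : ℤ) : ℚ) := by
      rw [← hu]
      push_cast
      rfl
    have key : ruleAffine R h ω.2 ∈ ruleAffine R h '' ratSet (H R.src) ↔
        ruleAffine R h ω.2 ∈ ratSet (H R.dst) := by
      rw [hu', mem_ratSet, ← hH, ← ruleAffine_apply h, (ruleAffine R h).injective.mem_set_image,
        mem_ratSet]
    rw [Equiv.swap_apply_def]
    split_ifs with h1 h2
    · rw [h1, key]
    · rw [h2, key]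
    · rfl
  · exact h0

theorem ruleAct_src : ruleAct H R h (ratSet (H R.src), fun j => (R.add j : ℚ)) =
    (ratSet (H R.dst), fun j => (R.add' j : ℚ)) := by
  have h1 : ruleAffine R h (fun j => (R.add j : ℚ)) = fun j => (R.add' j : ℚ) := by
    funext j
    simp [ruleAffine]
  have h2 : (fun j => (R.add' j : ℚ)) ∈ ruleLattice R := ⟨0, by simp⟩
  rw [ruleAct_apply]
  dsimp only
  rw [h1, if_pos h2, Equiv.swap_apply_left]

theorem ruleAct_shift [DecidableEq ι] (j : ι) :
    ruleAct H R h * pointShift (Multiplicative.ofAdd (Pi.single j 1)) ^ R.mul j =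
      pointShift (Multiplicative.ofAdd (Pi.single j 1)) ^ R.mul' j * ruleAct H R h := by
  classical
  rw [← map_pow pointShift, ← map_pow pointShift, ← ofAdd_nsmul, ← ofAdd_nsmul]
  ext1 ω
  have h1 : ruleAffine R h (R.mul j • Pi.single j 1 + ω.2) =
      R.mul' j • Pi.single j 1 + ruleAffine R h ω.2 := by
    funext i
    have h1 := (h i).1.ne'
    rcases eq_or_ne i j with rfl | hij
    · simp [ruleAffine]
      field_simp
      ring
    · simp [ruleAffine, hij]
  have h2 : R.mul' j • Pi.single j 1 + ruleAffine R h ω.2 ∈ ruleLattice R ↔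
      ruleAffine R h ω.2 ∈ ruleLattice R := by
    constructor
    · rintro ⟨u, hu⟩
      refine ⟨u - Pi.single j 1, ?_⟩
      funext i
      have := congrFun hu i
      rcases eq_or_ne i j with rfl | hij
      · simp at this ⊢
        linarith
      · simpa [hij] using this
    · rintro ⟨u, hu⟩
      refine ⟨u + Pi.single j 1, ?_⟩
      funext i
      have := congrFun hu i
      rcases eq_or_ne i j with rfl | hij
      · simp at this ⊢
        linarith
      · simpa [hij] using this
  simp only [Equiv.Perm.mul_apply, ruleAct_apply, pointShift_apply, toAdd_ofAdd, h1, h2]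

variable [Fintype ι] {rule : I → AffineRule ι S} {s₀ : S} {c₀ : ι → ℕ}

open MachineGen

theorem mem_of_test_mem {H : S → Set (ι → ℤ)}
    (hpos : ∀ i j, 0 < (rule i).mul j ∧ 0 < (rule i).mul' j)
    (hH : ∀ i (u : ι → ℤ),
      (fun j => ((rule i).mul j * u j + (rule i).add j : ℤ)) ∈ H (rule i).src ↔
        (fun j => ((rule i).mul' j * u j + (rule i).add' j : ℤ)) ∈ H (rule i).dst)
    (h₀ : (fun j => (c₀ j : ℤ)) ∈ H s₀) {s : S} {c : ι → ℕ}
    (h : test s c ∈ Subgroup.normalClosure (Set.range (machineRel rule s₀ c₀))) :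
    (fun j => (c j : ℤ)) ∈ H s := by
  classical
  let Φ : FreeGroup (MachineGen ι S I) →* Equiv.Perm (ModelBase ι × Fin 3) :=
    FreeGroup.lift fun z => match z with
      | .inl j => baseAct (pointShift (Multiplicative.ofAdd (Pi.single j 1)))
      | .inr (.inl s) => lamp (ratSet (H s), 0)
      | .inr (.inr (.inl i)) => baseAct (ruleAct H (rule i) (hpos i))
      | .inr (.inr (.inr ())) => tester
  have hx : ∀ j, Φ (x j) = baseAct (pointShift (Multiplicative.ofAdd (Pi.single j 1))) := by
    simp [Φ, x]
  have ht : ∀ s, Φ (t s) = lamp (ratSet (H s), 0) := by simp [Φ, t]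
  have hr : ∀ i, Φ (r i) = baseAct (ruleAct H (rule i) (hpos i)) := by simp [Φ, r]
  have hκ : Φ κ = tester := by simp [Φ, κ]
  have hcfg : ∀ s c, Φ (cfg s c) = lamp (ratSet (H s), fun j => (c j : ℚ)) := by
    intro s c
    have : Φ (multiPow x c) = baseAct (pointShift (Multiplicative.ofAdd fun j => (c j : ℚ))) := by
      rw [← multiPow_single, map_multiPow, map_multiPow, map_multiPow]
      simp only [hx]
    rw [cfg, map_mul, map_mul, map_inv, this, ht, baseAct_conj_lamp]
    congr 1
    ext1 <;> simp
  have htest : ∀ s c, Φ (test s c) = 1 ↔ (fun j => (c j : ℤ)) ∈ H s := by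
    intro s c
    rw [test, map_mul, map_mul, map_mul, map_inv, map_inv, mul_mul_inv_mul_inv_eq_one_iff, hκ,
      hcfg, tester_commute_lamp_iff, ← mem_ratSet]
    rfl
  have hle : Subgroup.normalClosure (Set.range (machineRel rule s₀ c₀)) ≤ Φ.ker := by
    refine Subgroup.normalClosure_le_normal ?_
    rintro _ ⟨j, rfl⟩
    change Φ _ = 1
    match j with
    | .inl (i, j) =>
      simp only [machineRel, map_mul, map_inv]
      rw [mul_mul_inv_mul_inv_eq_one_iff, hx, hx]
      exact ((Commute.all _ _).map pointShift).map baseAct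
    | .inr (.inl (i, j)) =>
      simp only [machineRel, map_mul, map_inv, map_pow]
      rw [mul_inv_eq_one, mul_inv_eq_iff_eq_mul, hx, hr, ← map_pow baseAct,
        ← map_pow baseAct, ← map_mul baseAct, ← map_mul baseAct, ruleAct_shift]
    | .inr (.inr (.inl i)) =>
      simp only [machineRel, map_mul, map_inv]
      rw [mul_inv_eq_one, hr, hcfg, hcfg, baseAct_conj_lamp, ruleAct_src]
    | .inr (.inr (.inr (.inl i))) =>
      simp only [machineRel, map_mul, map_inv]
      rw [mul_mul_inv_mul_inv_eq_one_iff, hκ, hr]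
      exact tester_commute_baseAct (ruleAct_mem_iff _ (hH i))
    | .inr (.inr (.inr (.inr ()))) => exact (htest _ _).2 h₀
  exact (htest _ _).1 (hle h)

end Model

section StackMachines

open Turing TM2 StateTransition MachineGen

variable {K G Λ σ : Type} [DecidableEq K] [Fintype G]

/-- The digit of a stack symbol. -/
noncomputable def symNum (g : G) : ℕ := Fintype.equivFin G g + 1

/-- The digit of an optional stack symbol, zero for no symbol. -/
noncomputable def optNum (o : Option G) : ℕ := o.elim 0 symNum

variable (G) in
/-- The base of the positional system coding stacks. -/
def stackBase : ℕ := Fintype.card G + 1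

/-- The number coding a stack, with the top of the stack as the lowest digit. -/
noncomputable def stackNum (l : List G) : ℕ := l.foldr (fun g n => symNum g + stackBase G * n) 0

@[simp]
theorem stackNum_nil : stackNum ([] : List G) = 0 := rfl

@[simp]
theorem stackNum_cons (g : G) (l : List G) :
    stackNum (g :: l) = symNum g + stackBase G * stackNum l := rfl

@[simp]
theorem optNum_some (g : G) : optNum (some g) = symNum g := rfl

@[simp]
theorem optNum_none : optNum (none : Option G) = 0 := rfl

theorem optNum_lt (o : Option G) : optNum o < stackBase G := by
  cases o with
  | none => exact Nat.succ_pos _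
  | some g => exact Nat.succ_lt_succ (Fintype.equivFin G g).2

theorem optNum_injective : Function.Injective (optNum : Option G → ℕ) := by
  intro o o' h
  cases o <;> cases o' <;> simp [symNum] at h ⊢
  exact (Fintype.equivFin G).injective (Fin.ext h)

theorem stackBase_pos : 0 < stackBase G := Nat.succ_pos _

theorem stackNum_head_tail (l : List G) :
    stackBase G * stackNum l.tail + optNum l.head? = stackNum l := by
  cases l <;> simp [add_comm]

theorem add_optNum_eq_stackNum_iff (l : List G) (o : Option G) (u : ℤ) :
    (stackBase G : ℤ) * u + optNum o = stackNum l ↔ o = l.head? ∧ u = stackNum l.tail := by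
  constructor
  · intro h
    rw [← stackNum_head_tail l] at h
    push_cast at h
    have hb : (0 : ℤ) < stackBase G := mod_cast stackBase_pos (G := G)
    have h1 : (optNum o : ℤ) < stackBase G := mod_cast optNum_lt o
    have h2 : (optNum l.head? : ℤ) < stackBase G := mod_cast optNum_lt l.head?
    have h3 : u = stackNum l.tail := by
      have e1 := congrArg (· / (stackBase G : ℤ)) h
      have hb' : stackBase G ≠ 0 := stackBase_pos.ne'
      simpa [hb', Int.mul_add_ediv_left, Int.add_ediv_of_dvd_left, hb.ne',
        Int.ediv_eq_zero_of_lt (Int.natCast_nonneg _) h1,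
        Int.ediv_eq_zero_of_lt (Int.natCast_nonneg _) h2] using e1
    subst h3
    exact ⟨optNum_injective (by exact_mod_cast add_left_cancel h), rfl⟩
  · rintro ⟨rfl, rfl⟩
    exact_mod_cast stackNum_head_tail l

/-- The statements occurring in the bodies of the labels in `supp`. -/
noncomputable def progStmts (M : Λ → Stmt (fun _ : K => G) Λ σ) (supp : Finset Λ) :
    Finset (Stmt (fun _ : K => G) Λ σ) :=
  open Classical in insert .halt (supp.biUnion fun l => stmts₁ (M l))

variable {M : Λ → Stmt (fun _ : K => G) Λ σ} {supp : Finset Λ}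
  {q q' : Stmt (fun _ : K => G) Λ σ}

omit [DecidableEq K] [Fintype G] in
theorem halt_mem_progStmts : .halt ∈ progStmts M supp := by simp [progStmts]

omit [DecidableEq K] [Fintype G] in
theorem apply_mem_progStmts {l : Λ} (h : l ∈ supp) : M l ∈ progStmts M supp := by
  simp only [progStmts, Finset.mem_insert, Finset.mem_biUnion]
  exact .inr ⟨l, h, stmts₁_self⟩

omit [DecidableEq K] [Fintype G] in
theorem mem_progStmts_of_mem_stmts₁ (h : q ∈ progStmts M supp) (h' : q' ∈ stmts₁ q) :
    q' ∈ progStmts M supp := by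
  simp only [progStmts, Finset.mem_insert, Finset.mem_biUnion] at h ⊢
  rcases h with rfl | ⟨l, hl, h⟩
  · rw [stmts₁, Finset.mem_singleton] at h'
    exact .inl h'
  · exact .inr ⟨l, hl, stmts₁_trans h h'⟩

omit [DecidableEq K] [Fintype G] in
theorem supportsStmt_of_mem_progStmts (hs : ∀ l ∈ supp, SupportsStmt supp (M l))
    (h : q ∈ progStmts M supp) : SupportsStmt supp q := by
  simp only [progStmts, Finset.mem_insert, Finset.mem_biUnion] at h
  rcases h with rfl | ⟨l, hl, h⟩
  · trivial
  · exact stmts₁_supportsStmt_mono h (hs l hl)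

variable (M supp) in
/-- The statements of a program, as a type. -/
abbrev ProgStmt : Type := {q // q ∈ progStmts M supp}

variable (M supp q) in
open Classical in
/-- A statement as an element of the type of statements of a program. -/
noncomputable def toProg : ProgStmt M supp :=
  if h : q ∈ progStmts M supp then ⟨q, h⟩ else ⟨.halt, halt_mem_progStmts⟩

omit [DecidableEq K] [Fintype G] in
theorem toProg_of_mem (h : q ∈ progStmts M supp) : toProg M supp q = ⟨q, h⟩ := dif_pos h

variable (M supp) in
/-- The affine rules of a stack machine: the rule with index `(q, v, o)` performs the statement
`q` in internal state `v`, assuming that `o` is the result of reading the stack. -/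
noncomputable def stackRule (i : ProgStmt M supp × σ × Option G) :
    AffineRule K (ProgStmt M supp × σ) :=
  match i with
  | (q, v, o) => match q.1 with
    | .push k f q' =>
      ⟨(q, v), (toProg M supp q', v), 1, 0, Function.update 1 k (stackBase G),
        Function.update 0 k (symNum (f v))⟩
    | .peek k f q' =>
      ⟨(q, v), (toProg M supp q', f v o), Function.update 1 k (stackBase G),
        Function.update 0 k (optNum o), Function.update 1 k (stackBase G),
        Function.update 0 k (optNum o)⟩
    | .pop k f q' =>
      ⟨(q, v), (toProg M supp q', f v o), Function.update 1 k (stackBase G),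
        Function.update 0 k (optNum o), Function.update 1 k (if o.isNone then stackBase G else 1),
        0⟩
    | .load a q' => ⟨(q, v), (toProg M supp q', a v), 1, 0, 1, 0⟩
    | .branch f q₁ q₂ => ⟨(q, v), (toProg M supp (cond (f v) q₁ q₂), v), 1, 0, 1, 0⟩
    | .goto l => ⟨(q, v), (toProg M supp (M (l v)), v), 1, 0, 1, 0⟩
    | .halt => ⟨(q, v), (q, v), 1, 0, 1, 0⟩

theorem stackRule_pos (i : ProgStmt M supp × σ × Option G) (j : K) :
    0 < (stackRule M supp i).mul j ∧ 0 < (stackRule M supp i).mul' j := by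
  have h1 : ∀ k : K, 0 < Function.update (1 : K → ℕ) k (stackBase G) j := fun k => by
    rcases eq_or_ne j k with rfl | h
    · simp [stackBase_pos]
    · simp [h]
  have h2 : ∀ (k : K) (o : Option G),
      0 < Function.update (1 : K → ℕ) k (if o.isNone then stackBase G else 1) j := fun k o => by
    cases o
    · exact h1 k
    · simp
  obtain ⟨⟨q, hq⟩, v, o⟩ := i
  cases q <;> simp [stackRule, h1, h2, -Option.isNone_iff_eq_none]

/-- The statement `q`, run from the given internal state and stacks, ends in the final
configuration `fc`. -/
def EndsIn (M : Λ → Stmt (fun _ : K => G) Λ σ) (fc : Cfg (fun _ : K => G) Λ σ)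
    (q : Stmt (fun _ : K => G) Λ σ) (v : σ) (S : K → List G) : Prop :=
  fc ∈ eval (step M) (stepAux q v S)

/-- The codes of the stacks from which a statement ends in `fc`. -/
def endSet (M : Λ → Stmt (fun _ : K => G) Λ σ) (supp : Finset Λ)
    (fc : Cfg (fun _ : K => G) Λ σ) (s : ProgStmt M supp × σ) : Set (K → ℤ) :=
  {c | ∃ S : K → List G, c = (fun k => (stackNum (S k) : ℤ)) ∧ EndsIn M fc s.1.1 s.2 S}

omit [Fintype G] in
theorem endsIn_goto {fc : Cfg (fun _ : K => G) Λ σ} {l : σ → Λ} {v : σ} {S : K → List G} :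
    EndsIn M fc (.goto l) v S ↔ EndsIn M fc (M (l v)) v S := by
  unfold EndsIn
  have : Reaches (step M) ⟨some (l v), v, S⟩ (stepAux (M (l v)) v S) :=
    Relation.ReflTransGen.single (by simp)
  rw [stepAux, reaches_eval this]

theorem stackRule_mem_endSet_iff (hs : ∀ l ∈ supp, SupportsStmt supp (M l))
    (fc : Cfg (fun _ : K => G) Λ σ) (i : ProgStmt M supp × σ × Option G) (u : K → ℤ) :
    (fun j => ((stackRule M supp i).mul j * u j + (stackRule M supp i).add j : ℤ)) ∈
        endSet M supp fc (stackRule M supp i).src ↔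
      (fun j => ((stackRule M supp i).mul' j * u j + (stackRule M supp i).add' j : ℤ)) ∈
        endSet M supp fc (stackRule M supp i).dst := by
  have hsub : ∀ q q', q ∈ progStmts M supp → q' ∈ stmts₁ q → q' ∈ progStmts M supp :=
    fun q q' => mem_progStmts_of_mem_stmts₁
  obtain ⟨⟨q, hq⟩, v, o⟩ := i
  cases q with
  | push k f q' =>
    have hq' := hsub _ _ hq (by simp [stmts₁, stmts₁_self] : q' ∈ _)
    simp only [stackRule, toProg_of_mem hq', endSet, Set.mem_ofPred_eq]
    constructor
    · rintro ⟨S, hS, h⟩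
      refine ⟨Function.update S k (f v :: S k), ?_, h⟩
      funext j
      have := congrFun hS j
      rcases eq_or_ne j k with rfl | hj
      · simp at this
        simp [this, add_comm]
      · simpa [hj] using this
    · rintro ⟨S, hS, h⟩
      have hk := congrFun hS k
      simp only [Function.update_self] at hk
      rw [← optNum_some, add_optNum_eq_stackNum_iff] at hk
      refine ⟨Function.update S k (S k).tail, ?_, ?_⟩
      · funext j
        have := congrFun hS j
        rcases eq_or_ne j k with rfl | hj
        · simpa using hk.2
        · simpa [hj] using this
      · have e : Function.update S k (f v :: (S k).tail) = S := by
          rw [Function.update_eq_self_iff]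
          exact (List.eq_cons_of_mem_head? hk.1.symm).symm
        unfold EndsIn at h ⊢
        simpa [e] using h
  | peek k f q' =>
    have hq' := hsub _ _ hq (by simp [stmts₁, stmts₁_self] : q' ∈ _)
    simp only [stackRule, toProg_of_mem hq', endSet, Set.mem_ofPred_eq]
    refine exists_congr fun S => and_congr_right fun hS => ?_
    have hk := congrFun hS k
    simp only [Function.update_self] at hk
    rw [add_optNum_eq_stackNum_iff] at hk
    rw [hk.1]
    rfl
  | pop k f q' =>
    have hq' := hsub _ _ hq (by simp [stmts₁, stmts₁_self] : q' ∈ _)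
    simp only [stackRule, toProg_of_mem hq', endSet, Set.mem_ofPred_eq]
    constructor
    · rintro ⟨S, hS, h⟩
      have hk := congrFun hS k
      simp only [Function.update_self] at hk
      rw [add_optNum_eq_stackNum_iff] at hk
      obtain ⟨rfl, hk⟩ := hk
      refine ⟨Function.update S k (S k).tail, ?_, h⟩
      funext j
      have := congrFun hS j
      rcases eq_or_ne j k with rfl | hj
      · cases hSj : S j with
        | nil => simp [hSj] at hk; simp [hk]
        | cons g l => simp [hSj] at hk; simp [hk]
      · simpa [hj] using this
    · rintro ⟨S, hS, h⟩
      have hk := congrFun hS k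
      cases o with
      | none =>
        simp only [Function.update_self, Option.isNone_none, if_true, Pi.zero_apply] at hk
        rw [← optNum_none (G := G), add_optNum_eq_stackNum_iff] at hk
        have hSk : S k = [] := List.head?_eq_none_iff.1 hk.1.symm
        refine ⟨S, ?_, ?_⟩
        · funext j
          have := congrFun hS j
          rcases eq_or_ne j k with rfl | hj
          · simpa using this
          · simpa [hj] using this
        · have e : Function.update S k [] = S := by
            rw [Function.update_eq_self_iff, hSk]
          unfold EndsIn at h ⊢
          simpa [hSk, e] using h
      | some g =>
        simp at hk
        refine ⟨Function.update S k (g :: S k), ?_, ?_⟩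
        · funext j
          have := congrFun hS j
          rcases eq_or_ne j k with rfl | hj
          · simp [hk, add_comm]
          · simpa [hj] using this
        · unfold EndsIn at h ⊢
          simpa using h
  | load a q' =>
    have hq' := hsub _ _ hq (by simp [stmts₁, stmts₁_self] : q' ∈ _)
    simp only [stackRule, toProg_of_mem hq']
    rfl
  | branch f q₁ q₂ =>
    have hq' := hsub _ _ hq (by cases f v <;> simp [stmts₁, stmts₁_self] : cond (f v) q₁ q₂ ∈ _)
    simp only [stackRule, toProg_of_mem hq']
    refine exists_congr fun S => and_congr_right fun _ => ?_
    unfold EndsIn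
    dsimp only [stepAux]
    cases f v <;> rfl
  | goto l =>
    have hl := supportsStmt_of_mem_progStmts hs hq v
    simp only [stackRule, toProg_of_mem (apply_mem_progStmts hl)]
    exact exists_congr fun S => and_congr_right fun _ => endsIn_goto
  | halt => rfl

variable [Fintype K] {fc : Cfg (fun _ : K => G) Λ σ}

variable (M supp fc) in
/-- The relators of the group of a stack machine with final configuration `fc`. -/
noncomputable abbrev stackRel :=
  machineRel (stackRule M supp) (toProg M supp .halt, fc.var) fun k => stackNum (fc.stk k)

variable (M supp fc) in
/-- The normal subgroup generated by the relators of the group of a stack machine. -/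
noncomputable abbrev stackKer := Subgroup.normalClosure (Set.range (stackRel M supp fc))

omit [Fintype K] in
theorem update_mul_add_stackNum (S : K → List G) (k : K) :
    (Function.update (1 : K → ℕ) k (stackBase G) * fun j => stackNum (Function.update S k (S k).tail j)) +
      Function.update (0 : K → ℕ) k (optNum (S k).head?) = fun j => stackNum (S j) := by
  funext j
  rcases eq_or_ne j k with rfl | hj
  · simp [stackNum_head_tail]
  · simp [hj]

theorem test_mem_of_stepAux (hs : ∀ l ∈ supp, SupportsStmt supp (M l)) {P : Cfg _ Λ σ → Prop}
    (hnone : ∀ v S, P ⟨none, v, S⟩ →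
      test (toProg M supp .halt, v) (fun k => stackNum (S k)) ∈ stackKer M supp fc)
    (hsome : ∀ l ∈ supp, ∀ v S, P ⟨some l, v, S⟩ →
      test (toProg M supp (M l), v) (fun k => stackNum (S k)) ∈ stackKer M supp fc)
    (hq : q ∈ progStmts M supp) (v : σ) (S : K → List G) (h : P (stepAux q v S)) :
    test (toProg M supp q, v) (fun k => stackNum (S k)) ∈ stackKer M supp fc := by
  have hsub : ∀ q q', q ∈ progStmts M supp → q' ∈ stmts₁ q → q' ∈ progStmts M supp :=
    fun q q' => mem_progStmts_of_mem_stmts₁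
  induction q generalizing v S with
  | push k f q' ih =>
    have hq' := hsub _ _ hq (by simp [stmts₁, stmts₁_self] : q' ∈ _)
    have := (machine_rule_iff (rule := stackRule M supp)
      (s₀ := (toProg M supp .halt, fc.var)) (c₀ := fun k => stackNum (fc.stk k))
      (toProg M supp (.push k f q'), v, none) fun k => stackNum (S k)).2
    rw [toProg_of_mem hq] at this ⊢
    simp only [stackRule, one_mul, add_zero] at this
    refine this ?_
    have h' := ih hq' _ _ h
    convert h' using 2
    funext j
    rcases eq_or_ne j k with rfl | hj
    · simp [add_comm]
    · simp [hj]
  | peek k f q' ih =>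
    have hq' := hsub _ _ hq (by simp [stmts₁, stmts₁_self] : q' ∈ _)
    have := (machine_rule_iff (rule := stackRule M supp)
      (s₀ := (toProg M supp .halt, fc.var)) (c₀ := fun k => stackNum (fc.stk k))
      (toProg M supp (.peek k f q'), v, (S k).head?)
      fun j => stackNum (Function.update S k (S k).tail j)).2
    rw [toProg_of_mem hq] at this ⊢
    simp only [stackRule, update_mul_add_stackNum] at this
    exact this (ih hq' _ _ h)
  | pop k f q' ih =>
    have hq' := hsub _ _ hq (by simp [stmts₁, stmts₁_self] : q' ∈ _)
    have := (machine_rule_iff (rule := stackRule M supp)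
      (s₀ := (toProg M supp .halt, fc.var)) (c₀ := fun k => stackNum (fc.stk k))
      (toProg M supp (.pop k f q'), v, (S k).head?)
      fun j => stackNum (Function.update S k (S k).tail j)).2
    rw [toProg_of_mem hq] at this ⊢
    simp only [stackRule, update_mul_add_stackNum] at this
    refine this ?_
    have h' := ih hq' _ _ h
    convert h' using 2
    funext j
    rcases eq_or_ne j k with rfl | hj
    · cases hS : S j <;> simp
    · simp [hj]
  | load a q' ih =>
    have hq' := hsub _ _ hq (by simp [stmts₁, stmts₁_self] : q' ∈ _)
    have := (machine_rule_iff (rule := stackRule M supp)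
      (s₀ := (toProg M supp .halt, fc.var)) (c₀ := fun k => stackNum (fc.stk k))
      (toProg M supp (.load a q'), v, none) fun k => stackNum (S k)).2
    rw [toProg_of_mem hq] at this ⊢
    simp only [stackRule, one_mul, add_zero] at this
    exact this (ih hq' _ _ h)
  | branch f q₁ q₂ ih₁ ih₂ =>
    have hq₁ := hsub _ _ hq (by simp [stmts₁, stmts₁_self] : q₁ ∈ _)
    have hq₂ := hsub _ _ hq (by simp [stmts₁, stmts₁_self] : q₂ ∈ _)
    have := (machine_rule_iff (rule := stackRule M supp)
      (s₀ := (toProg M supp .halt, fc.var)) (c₀ := fun k => stackNum (fc.stk k))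
      (toProg M supp (.branch f q₁ q₂), v, none) fun k => stackNum (S k)).2
    rw [toProg_of_mem hq] at this ⊢
    simp only [stackRule, one_mul, add_zero] at this
    refine this ?_
    rw [stepAux] at h
    cases hf : f v
    · exact ih₂ hq₂ _ _ (by simpa [hf] using h)
    · exact ih₁ hq₁ _ _ (by simpa [hf] using h)
  | goto l =>
    have hl := supportsStmt_of_mem_progStmts hs hq v
    have := (machine_rule_iff (rule := stackRule M supp)
      (s₀ := (toProg M supp .halt, fc.var)) (c₀ := fun k => stackNum (fc.stk k))
      (toProg M supp (.goto l), v, none) fun k => stackNum (S k)).2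
    rw [toProg_of_mem hq] at this ⊢
    simp only [stackRule, one_mul, add_zero] at this
    exact this (hsome _ hl _ _ h)
  | halt => exact hnone v S h

theorem test_mem_stackKer_iff (hs : ∀ l ∈ supp, SupportsStmt supp (M l)) (hfc : fc.l = none)
    {l : Λ} (hl : l ∈ supp) (v : σ) (S : K → List G) :
    test (toProg M supp (M l), v) (fun k => stackNum (S k)) ∈ stackKer M supp fc ↔
      fc ∈ eval (step M) ⟨some l, v, S⟩ := by
  have hinj : Function.Injective (stackNum : List G → ℕ) := by
    intro l
    induction l with
    | nil =>
      intro l' h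
      cases l' with
      | nil => rfl
      | cons g l' =>
        simp only [stackNum_nil, stackNum_cons, symNum] at h
        omega
    | cons g l ih =>
      intro l' h
      have := (add_optNum_eq_stackNum_iff l' (some g) (stackNum l)).1
        (by rw [← h]; simp [add_comm])
      rw [List.eq_cons_of_mem_head? this.1.symm, ih (by exact_mod_cast this.2)]
  obtain ⟨lc, vc, Sc⟩ := fc
  obtain rfl : lc = none := hfc
  have hM : Reaches (step M) ⟨some l, v, S⟩ (stepAux (M l) v S) :=
    Relation.ReflTransGen.single (by simp)
  constructor
  · intro h
    have := mem_of_test_mem (H := endSet M supp ⟨none, vc, Sc⟩) (fun i j => stackRule_pos i j)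
      (stackRule_mem_endSet_iff hs _) ?_ h
    · obtain ⟨S', hS, h'⟩ := this
      obtain rfl : S = S' := by
        funext k
        exact hinj (by exact_mod_cast congrFun hS k)
      rw [toProg_of_mem (apply_mem_progStmts hl)] at h'
      rwa [reaches_eval hM]
    · rw [toProg_of_mem halt_mem_progStmts]
      exact ⟨Sc, rfl, mem_eval.2 ⟨.refl, rfl⟩⟩
  · intro h
    have hr := (mem_eval.1 h).1
    have key : ∀ c, Reaches (step M) c ⟨none, vc, Sc⟩ →
        match c with
        | ⟨none, v, S⟩ => test (toProg M supp .halt, v) (fun k => stackNum (S k)) ∈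
            stackKer M supp ⟨none, vc, Sc⟩
        | ⟨some l, v, S⟩ => l ∈ supp → test (toProg M supp (M l), v) (fun k => stackNum (S k)) ∈
            stackKer M supp ⟨none, vc, Sc⟩ := by
      intro c hc
      induction hc using Relation.ReflTransGen.head_induction_on with
      | refl => exact machine_start_mem
      | @head a b hab _ ih =>
        obtain ⟨_ | l, v, S⟩ := a
        · simp at hab
        · intro hl
          simp only [step, Option.mem_some_iff] at hab
          subst hab
          refine test_mem_of_stepAux hs (P := fun c => match c with
          | ⟨none, v, S⟩ => test (toProg M supp .halt, v) (fun k => stackNum (S k)) ∈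
              stackKer M supp ⟨none, vc, Sc⟩
          | ⟨some l, v, S⟩ => l ∈ supp → test (toProg M supp (M l), v)
              (fun k => stackNum (S k)) ∈ stackKer M supp ⟨none, vc, Sc⟩)
            (fun v S h => h) (fun l hl v S h => h hl) (apply_mem_progStmts hl) v S ih
    exact key _ hr hl

end StackMachines

section Undecidability

open Turing PartrecToTM2 MachineGen

theorem trNat_of_ne_zero {n : ℕ} (hn : n ≠ 0) :
    trNat n = (if n % 2 = 0 then Γ'.bit0 else Γ'.bit1) :: trNat (n / 2) := by
  obtain ⟨p, rfl⟩ : ∃ p : PosNum, (p : ℕ) = n := by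
    have h := Num.to_of_nat n
    cases hp : (n : Num) with
    | zero =>
      rw [hp] at h
      exact absurd h.symm hn
    | pos p =>
      rw [hp] at h
      exact ⟨p, h⟩
  have h : ∀ p : PosNum, trNat p = trPosNum p := fun p => by
    rw [trNat, PosNum.of_to_nat, trNum]
  cases p with
  | one => exact h 1
  | bit0 p =>
    have h1 : (p.bit0 : ℕ) = 2 * p := by rw [PosNum.cast_bit0, two_mul]
    rw [h, h1, Nat.mul_mod_right, if_pos rfl, Nat.mul_div_cancel_left _ two_pos, h, trPosNum]
  | bit1 p =>
    have h1 : (p.bit1 : ℕ) = 2 * p + 1 := by rw [PosNum.cast_bit1, two_mul]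
    rw [h, h1, if_neg (by omega), show (2 * (p : ℕ) + 1) / 2 = p by omega, h, trPosNum]

/-- The four stacks. -/
instance : Fintype K' := ⟨{.main, .rev, .aux, .stack}, fun k => by cases k <;> decide⟩

/-- The code of the stack holding a single number. -/
noncomputable def inputNum (n : ℕ) : ℕ := stackNum (trList [n])

theorem inputNum_zero : inputNum 0 = symNum Γ'.cons := by simp [inputNum]

theorem inputNum_of_ne_zero {n : ℕ} (hn : n ≠ 0) :
    inputNum n = symNum (if n % 2 = 0 then Γ'.bit0 else Γ'.bit1) +
      stackBase Γ' * inputNum (n / 2) := by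
  simp [inputNum, trNat_of_ne_zero hn]

theorem primrec_inputNum : Primrec inputNum := by
  let g : Unit → List ℕ → Option ℕ := fun _ l =>
    if l.length = 0 then some (symNum Γ'.cons) else
      (l[l.length / 2]?).map fun k =>
        (if l.length % 2 = 0 then symNum Γ'.bit0 else symNum Γ'.bit1) + stackBase Γ' * k
  have hl : Primrec fun p : Unit × List ℕ => p.2.length := Primrec.list_length.comp .snd
  have hg : Primrec₂ g := by
    refine Primrec.ite (Primrec.eq.comp hl (.const 0)) (.const _) ?_
    refine Primrec.option_map (Primrec.list_getElem?.comp .snd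
      (Primrec.nat_div.comp hl (.const 2))) ?_
    refine Primrec.nat_add.comp (Primrec.ite (Primrec.eq.comp (Primrec.nat_mod.comp
      (hl.comp .fst) (.const 2)) (.const 0)) (.const _) (.const _))
      (Primrec.nat_mul.comp (.const _) .snd)
  have := Primrec.nat_strong_rec (fun (_ : Unit) n => inputNum n) hg fun _ n => by
    rcases eq_or_ne n 0 with rfl | hn
    · simp [g, inputNum_zero]
    · have : n / 2 < n := Nat.div_lt_self (Nat.pos_of_ne_zero hn) one_lt_two
      rw [inputNum_of_ne_zero hn]
      simp [g, hn, List.getElem?_map, List.getElem?_range this, apply_ite symNum]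
  exact this.comp (.const ()) .id

theorem exists_code_undecidable : ∃ c : ToPartrec.Code,
    (∀ n, ∀ l ∈ c.eval [n], l = [0]) ∧ ¬ComputablePred fun n => (c.eval [n]).Dom := by
  let f : ℕ →. ℕ := fun n =>
    (Nat.Partrec.Code.eval (Denumerable.ofNat Nat.Partrec.Code n) 0).map fun _ => 0
  have hf : Partrec f :=
    (Nat.Partrec.Code.eval_part.comp (Computable.ofNat _) (.const 0)).map (.const 0)
  obtain ⟨c, hc⟩ := ToPartrec.Code.exists_code (Nat.Partrec'.part_iff₁.2 hf)
  have hc' : ∀ n, c.eval [n] = (f n).map fun k => [k] := fun n => hc ⟨[n], rfl⟩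
  refine ⟨c, fun n l hl => ?_, fun h => ?_⟩
  · rw [hc'] at hl
    simp [f] at hl
    exact hl.2.symm
  · refine ComputablePred.halting_problem 0 (ComputablePred.computable_of_manyOneReducible
      ⟨Encodable.encode, Computable.encode, fun c' => ?_⟩ h)
    simp [hc', f]

theorem exists_machine_undecidable : ∃ (S I : Type) (_ : Finite S) (_ : Finite I)
    (rule : I → AffineRule K' S) (s₀ : S) (c₀ : K' → ℕ) (s : S) (e : ℕ → ℕ), Primrec e ∧
      ¬ComputablePred fun n => test s (Pi.single .main (e n)) ∈
        Subgroup.normalClosure (Set.range (machineRel rule s₀ c₀)) := by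
  obtain ⟨c, hc, hu⟩ := exists_code_undecidable
  have hs := tr_supports c .halt
  let supp := codeSupp c .halt
  let fc : TM2.Cfg (fun _ : K' => Γ') Λ' (Option Γ') := PartrecToTM2.halt [0]
  have key : ∀ n, (c.eval [n]).Dom ↔
      test (toProg tr supp (tr (trNormal c .halt)), none) (Pi.single .main (inputNum n)) ∈
        stackKer tr supp fc := by
    intro n
    have h1 := test_mem_stackKer_iff (fc := fc) hs.2 rfl hs.1 none (K'.elim (trList [n]) [] [] [])
    have h2 : (fun k => stackNum (K'.elim (trList [n]) [] [] [] k)) =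
        Pi.single .main (inputNum n) := by
      funext k
      cases k <;> simp [inputNum]
    rw [h2] at h1
    refine Iff.trans ?_ h1.symm
    have h3 := tr_eval c [n]
    rw [init] at h3
    refine Iff.trans ?_ (Part.ext_iff.1 h3 fc).symm
    rw [Part.dom_iff_mem]
    constructor
    · rintro ⟨l, hl⟩
      obtain rfl := hc n l hl
      exact Part.mem_map _ hl
    · intro h
      obtain ⟨l, hl, -⟩ := (Part.mem_map_iff _).1 h
      exact ⟨l, hl⟩
  exact ⟨ProgStmt tr supp × Option Γ', ProgStmt tr supp × Option Γ' × Option Γ', inferInstance,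
    inferInstance, stackRule tr supp, (toProg tr supp .halt, fc.var), fun k => stackNum (fc.stk k),
    (toProg tr supp (tr (trNormal c .halt)), none), inputNum, primrec_inputNum,
    fun h => hu (by simpa only [key] using h)⟩

end Undecidability

section Relabelling

variable {X Y : Type} {rels : Set (FreeGroup X)}

theorem AreaLE.map (φ : X → Y) {w : Word X} {m : ℕ} (h : AreaLE rels w m) :
    AreaLE (FreeGroup.map φ '' rels) (w.map fun p => (φ p.1, p.2)) m := by
  obtain ⟨L, hL, hr, hp⟩ := h
  refine ⟨L.map (FreeGroup.map φ), by simpa using hL, fun g' hg' => ?_, ?_⟩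
  · obtain ⟨g, hg, rfl⟩ := List.mem_map.1 hg'
    obtain ⟨x, r, hr, rfl⟩ := hr g hg
    refine ⟨FreeGroup.map φ x, FreeGroup.map φ r, ?_, by simp⟩
    rw [← map_inv]
    exact hr.imp (Set.mem_image_of_mem _) (Set.mem_image_of_mem _)
  · rw [← map_list_prod, hp, FreeGroup.map.mk]

theorem DiamLE.map (φ : X → Y) {w : Word X} {m : ℕ} (h : DiamLE rels w m) :
    DiamLE (FreeGroup.map φ '' rels) (w.map fun p => (φ p.1, p.2)) m := by
  obtain ⟨L, hr, hp⟩ := h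
  refine ⟨L.map fun p => (p.1.map fun p => (φ p.1, p.2), FreeGroup.map φ p.2), fun p' hp' => ?_, ?_⟩
  · obtain ⟨p, hp, rfl⟩ := List.mem_map.1 hp'
    refine ⟨by simpa using (hr p hp).1, ?_⟩
    rw [← map_inv]
    exact (hr p hp).2.imp (Set.mem_image_of_mem _) (Set.mem_image_of_mem _)
  · rw [← FreeGroup.map.mk, ← hp, map_list_prod, List.map_map, List.map_map]
    congr 2
    funext p
    rw [Function.comp_apply, Function.comp_apply, map_mul, map_mul, map_inv, FreeGroup.map.mk]

variable (e : X ≃ Y)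

theorem map_mem_normalClosure_iff {g : FreeGroup X} :
    FreeGroup.map e g ∈ Subgroup.normalClosure (FreeGroup.map e '' rels) ↔
      g ∈ Subgroup.normalClosure rels := by
  rw [← Subgroup.map_normalClosure _ _ (FreeGroup.map_surjective e.surjective),
    Subgroup.mem_map_iff_mem (FreeGroup.map_injective e.injective)]

theorem exists_map_eq (w : Word Y) :
    ∃ w' : Word X, w'.length = w.length ∧ w'.map (fun p => (e p.1, p.2)) = w :=
  ⟨w.map fun p => (e.symm p.1, p.2), by simp, by simp [Function.comp_def]⟩

theorem oneIn_map_iff {w : Word X} :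
    OneIn (FreeGroup.map e '' rels) (w.map fun p => (e p.1, p.2)) ↔ OneIn rels w := by
  rw [OneIn, ← FreeGroup.map.mk, map_mem_normalClosure_iff, OneIn]

theorem IsIsoperimetric.map {f : ℕ → ℕ} (h : IsIsoperimetric rels f) :
    IsIsoperimetric (FreeGroup.map e '' rels) f := by
  intro n w hw h1
  obtain ⟨w, hl, rfl⟩ := exists_map_eq e w
  exact (h n w (hl ▸ hw) ((oneIn_map_iff e).1 h1)).map e

theorem IsIsodiametric.map {f : ℕ → ℕ} (h : IsIsodiametric rels f) :
    IsIsodiametric (FreeGroup.map e '' rels) f := by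
  intro n w hw h1
  obtain ⟨w, hl, rfl⟩ := exists_map_eq e w
  exact (h n w (hl ▸ hw) ((oneIn_map_iff e).1 h1)).map e

theorem isIsoperimetric_map_iff {f : ℕ → ℕ} :
    IsIsoperimetric (FreeGroup.map e '' rels) f ↔ IsIsoperimetric rels f := by
  refine ⟨fun h => ?_, IsIsoperimetric.map e⟩
  simpa [Set.image_image, FreeGroup.map.comp] using h.map e.symm

theorem conjIn_map_iff {w₁ w₂ : Word Y} {g₁ g₂ : FreeGroup X}
    (h₁ : FreeGroup.mk w₁ = FreeGroup.map e g₁) (h₂ : FreeGroup.mk w₂ = FreeGroup.map e g₂) :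
    ConjIn (FreeGroup.map e '' rels) w₁ w₂ ↔
      IsConj (QuotientGroup.mk' (Subgroup.normalClosure rels) g₁)
        (QuotientGroup.mk' (Subgroup.normalClosure rels) g₂) := by
  rw [ConjIn, h₁, h₂, (FreeGroup.map_surjective e.surjective).exists, isConj_iff,
    (QuotientGroup.mk'_surjective _).exists]
  refine exists_congr fun x => ?_
  rw [← map_inv, ← map_inv, ← map_mul, ← map_mul, ← map_mul, map_mem_normalClosure_iff,
    ← QuotientGroup.eq_one_iff, ← QuotientGroup.mk'_apply, map_mul, map_mul, map_mul, map_inv,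
    map_inv, mul_inv_eq_one]

theorem IsIsoperimetric.exists_isDehnFunction {f : ℕ → ℕ} (h : IsIsoperimetric rels f) :
    ∃ d, IsDehnFunction rels d := by
  refine ⟨fun n => sInf {m | ∀ w : Word X, w.length ≤ n → OneIn rels w → AreaLE rels w m},
    fun n => ?_, fun f hf n => Nat.sInf_le (hf n)⟩
  exact Nat.sInf_mem (s := {m | ∀ w : Word X, w.length ≤ n → OneIn rels w → AreaLE rels w m})
    ⟨_, h n⟩

theorem IsIsodiametric.exists_isSmallestIsodiametric {f : ℕ → ℕ} (h : IsIsodiametric rels f) :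
    ∃ d, IsSmallestIsodiametric rels d := by
  refine ⟨fun n => sInf {m | ∀ w : Word X, w.length ≤ n → OneIn rels w → DiamLE rels w m},
    fun n => ?_, fun f hf n => Nat.sInf_le (hf n)⟩
  exact Nat.sInf_mem (s := {m | ∀ w : Word X, w.length ≤ n → OneIn rels w → DiamLE rels w m})
    ⟨_, h n⟩

end Relabelling

section ComputableWords

variable {X : Type} [Primcodable X]

/-- A sequence of elements of a free group represented by a primitive recursive sequence of
words. -/
def PrimrecElements (F : ℕ → FreeGroup X) : Prop :=
  ∃ w : ℕ → Word X, Primrec w ∧ ∀ n, FreeGroup.mk (w n) = F n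

namespace PrimrecElements

theorem const (g : FreeGroup X) : PrimrecElements fun _ => g := by
  obtain ⟨w, rfl⟩ := Quot.exists_rep g
  exact ⟨fun _ => w, Primrec.const w, fun _ => rfl⟩

theorem mul {F F' : ℕ → FreeGroup X} (h : PrimrecElements F) (h' : PrimrecElements F') :
    PrimrecElements fun n => F n * F' n := by
  obtain ⟨w, hw, hF⟩ := h
  obtain ⟨w', hw', hF'⟩ := h'
  refine ⟨fun n => w n ++ w' n, Primrec.list_append.comp hw hw', fun n => ?_⟩
  rw [← FreeGroup.mul_mk, hF, hF']

theorem pow (g : FreeGroup X) {k : ℕ → ℕ} (hk : Primrec k) : PrimrecElements fun n => g ^ k n := by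
  obtain ⟨w, rfl⟩ := Quot.exists_rep g
  refine ⟨fun n => (w ++ ·)^[k n] [], Primrec.nat_iterate hk (Primrec.const [])
    (Primrec.list_append.comp (Primrec.const w) Primrec.snd), fun n => ?_⟩
  change FreeGroup.mk ((w ++ ·)^[k n] []) = FreeGroup.mk w ^ k n
  induction k n with
  | zero => rfl
  | succ m ih => rw [Function.iterate_succ_apply', pow_succ', ← FreeGroup.mul_mk, ih]

end PrimrecElements

open MachineGen in
theorem primrecElements_test {ι S I : Type} [Fintype ι] [DecidableEq ι] (s : S) (j : ι)
    {k : ℕ → ℕ} (hk : Primrec k) (φ : FreeGroup (MachineGen ι S I) →* FreeGroup X) :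
    PrimrecElements fun n => φ (test s (Pi.single j (k n))) := by
  have hx : ∀ n, multiPow (x : ι → FreeGroup (MachineGen ι S I)) (Pi.single j n) = x j ^ n := by
    intro n
    rw [multiPow, List.prod_map_eq_pow_single j _ (fun i hi _ => by simp [hi]),
      List.count_eq_one_of_mem (Finset.nodup_toList _) (by simp)]
    simp
  simp only [test, cfg, hx, mul_inv_rev, map_mul, map_inv, map_pow, inv_inv, ← inv_pow]
  have hc : ∀ g : FreeGroup X, PrimrecElements fun _ => g := PrimrecElements.const
  have hp : ∀ g : FreeGroup X, PrimrecElements fun n => g ^ k n := fun g => .pow g hk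
  exact (((hc _).mul (((hp _).mul (hc _)).mul (hp _))).mul (hc _)).mul
    ((hp _).mul ((hc _).mul (hp _)))

end ComputableWords

/-- Rips. There exists a finitely presented group with undecidable
conjugacy problem whose Dehn function is equivalent to `n³` and whose smallest
isodiametric function is linear. -/
theorem exists_group_undecidable_conjugacy_cubic_dehn :
    ∃ (m : ℕ) (rels : Set (FreeGroup (Fin m))) (d ι : ℕ → ℕ),
      rels.Finite ∧
      IsDehnFunction rels d ∧ FunEquiv d (fun n => n ^ 3) ∧
      IsSmallestIsodiametric rels ι ∧ FunEquiv ι (fun n => n) ∧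
      ¬ComputablePred (fun p : Word (Fin m) × Word (Fin m) => ConjIn rels p.1 p.2) := by
  obtain ⟨S, I, _, _, rule, s₀, c₀, s, k, hk, hu⟩ := exists_machine_undecidable
  set rs := machineRel rule s₀ c₀
  obtain ⟨m, ⟨e⟩⟩ := Finite.exists_equiv_fin (MillerGen (MachineGen Turing.PartrecToTM2.K' S I)
    ((Turing.PartrecToTM2.K' × Turing.PartrecToTM2.K') ⊕ (I × Turing.PartrecToTM2.K') ⊕ I ⊕ I ⊕
      Unit))
  obtain ⟨C, hC⟩ := exists_isoperimetric_miller rs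
  obtain ⟨D, hD⟩ := exists_isodiametric_miller rs
  obtain ⟨d, hd⟩ := (hC.map e).exists_isDehnFunction
  obtain ⟨ι, hι⟩ := (hD.map e).exists_isSmallestIsodiametric
  refine ⟨m, FreeGroup.map e '' millerRels rs, d, ι, (twistRels_finite _ _).image _, hd,
    ⟨⟨C, 1, 0, 0, fun n => ?_⟩, ⟨1, 8, 0, 0, fun n => ?_⟩⟩, hι,
    ⟨⟨0, 0, D, D, fun n => ?_⟩, ⟨0, 0, 1, 0, fun n => ?_⟩⟩, fun h => hu ?_⟩
  · simpa using hd.2 _ (hC.map e) n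
  · simpa using cube_le_isoperimetric_miller rs ((isIsoperimetric_map_iff e).1 hd.1) n
  · simpa using hι.2 _ (hD.map e) n
  · simp
  · obtain ⟨w, hw, hw'⟩ := (PrimrecElements.const (FreeGroup.map e (FreeGroup.of none))).mul
      (primrecElements_test s .main hk ((FreeGroup.map e).comp millerWord))
    refine ComputablePred.computable_of_manyOneReducible ⟨fun n => (w n, [(e none, true)]),
      (hw.pair (Primrec.const _)).to_comp, fun n => ?_⟩ h
    rw [conjIn_map_iff e (g₁ := FreeGroup.of none * millerWord _) (g₂ := FreeGroup.of none) ?_ ?_,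
      isConj_miller_iff]
    · rw [hw', map_mul]
      rfl
    · rfl
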